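/- arXiv:1203.5145 — 5 statements merged into one kernel-verified Lean document; each statement's English description precedes it below -/
import Mathlib

section
/- Let m ≥ 2 and N = 3m. The number of permutations σ of ℤ/Nℤ for which σ ∘ f is not topologically mixing equals 3·(2m)!·m!; equivalently, the proportion of such permutations among all N! permutations is the reciprocal of the binomial coefficient C(3m−1, 2m). -/
open Set

noncomputable def fract01 (y : ℝ) : Set.Ico (0:ℝ) 1 :=
  ⟨Int.fract y, Int.fract_nonneg y, Int.fract_lt_one y⟩

/-- The map `f(x) = m x mod 1` on `[0,1)`. -/
noncomputable def mulMap (m : ℕ) (x : Set.Ico (0:ℝ) 1) : Set.Ico (0:ℝ) 1 :=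
  fract01 (m * x.val)

/-- The interval exchange map on `[0,1)` induced by a permutation `σ` of `ℤ/Nℤ`,
permuting the `N` subintervals `I_j = [j/N, (j+1)/N)`. -/
noncomputable def permMap (N : ℕ) (σ : Equiv.Perm (ZMod N)) (x : Set.Ico (0:ℝ) 1) :
    Set.Ico (0:ℝ) 1 :=
  fract01 (x.val +
    (((σ ((⌊(N : ℝ) * x.val⌋ : ℤ) : ZMod N)).val : ℝ) -
      (((⌊(N : ℝ) * x.val⌋ : ℤ) : ZMod N)).val) / N)

/-- Topological mixing of a self-map of a topological space. -/
def TopMixing {X : Type*} [TopologicalSpace X] (g : X → X) : Prop :=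
  ∀ U V : Set X, IsOpen U → IsOpen V → U.Nonempty → V.Nonempty →
    ∃ n₀ : ℕ, ∀ n ≥ n₀, (g^[n] '' U ∩ V).Nonempty

/-- The subinterval `I_j = [j/N, (j+1)/N)` of `[0,1)`. -/
def Isub (N : ℕ) (j : ZMod N) : Set (Set.Ico (0:ℝ) 1) :=
  {x | (j.val : ℝ) / N ≤ x.val ∧ x.val < ((j.val : ℝ) + 1) / N}

/-- `f̃(A) = {m·a + d : a ∈ A, 0 ≤ d ≤ m−1} ⊆ ℤ/Nℤ`. -/
def ftil (m N : ℕ) (A : Set (ZMod N)) : Set (ZMod N) :=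
  {b | ∃ a ∈ A, ∃ d : ℕ, d < m ∧ b = (m : ZMod N) * a + (d : ZMod N)}


/-- The composition of multiplication by `m` with the interval exchange given by `σ`. -/
noncomputable def exchMul (m : ℕ) (σ : Equiv.Perm (ZMod (3 * m))) (x : Set.Ico (0:ℝ) 1) :
    Set.Ico (0:ℝ) 1 :=
  permMap (3 * m) σ (mulMap m x)

/-- The third of `ℤ/3mℤ` (consecutive blocks of length `m`) containing a residue. -/
def blockIdx (m : ℕ) (a : ZMod (3 * m)) : ZMod 3 := ((a.val / m : ℕ) : ZMod 3)

/-- The class modulo `3` of a residue modulo `3m`. -/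
def resIdx (m : ℕ) (a : ZMod (3 * m)) : ZMod 3 := (a.val : ZMod 3)

/-- `σ` carries the block `r` exactly onto the residue class `s`. -/
def Carries (m : ℕ) (σ : Equiv.Perm (ZMod (3 * m))) (r s : ZMod 3) : Prop :=
  ∀ a, blockIdx m a = r ↔ resIdx m (σ a) = s

/-- The interval of points whose expansion at scale `1 / (3m * m ^ p)` starts with `k`. -/
def gridCell (m p k : ℕ) : Set (Set.Ico (0:ℝ) 1) :=
  {x | ∃ s : ℝ, 0 ≤ s ∧ s < 1 ∧ x.val = (k + s) / (3 * m * m ^ p)}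

/-- The class modulo `3` of the index of the subinterval containing `x`. -/
noncomputable def classOf (m : ℕ) (x : Set.Ico (0:ℝ) 1) : ZMod 3 :=
  ((⌊(3 * m : ℝ) * x.val⌋₊ : ℕ) : ZMod 3)

lemma exchMul_val {m : ℕ} (hm : 0 < m) (σ : Equiv.Perm (ZMod (3 * m))) {u : ℝ} (hu0 : 0 ≤ u)
    (hu1 : u < 1) {j : ℕ} (hj : j < 3 * m) (a : ℕ) {x : Set.Ico (0:ℝ) 1}
    (hx : x.val = (u + j + 3 * m * a) / (3 * m * m)) :
    (exchMul m σ x).val = (u + ((σ (j : ZMod (3 * m))).val : ℝ)) / (3 * m) := by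
  have hm' : (0:ℝ) < m := by exact_mod_cast hm
  have : NeZero (3 * m) := ⟨by omega⟩
  have hj' : (j : ℝ) + 1 ≤ 3 * m := by exact_mod_cast hj
  have h1 : (mulMap m x).val = (u + j) / (3 * m) := by
    simp only [mulMap, fract01, hx]
    rw [Int.fract_eq_iff]
    refine ⟨by positivity, by rw [div_lt_one (by positivity)]; linarith, a, ?_⟩
    push_cast
    field_simp
    ring
  have h2 : ⌊((3 * m : ℕ) : ℝ) * (mulMap m x).val⌋ = (j : ℤ) := by
    rw [h1, Int.floor_eq_iff]
    have : ((3 * m : ℕ) : ℝ) * ((u + j) / (3 * m)) = u + j := by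
      push_cast; field_simp
    rw [this]
    push_cast
    constructor <;> linarith
  have h3 : ((j : ZMod (3 * m))).val = j := ZMod.val_cast_of_lt hj
  have h4 : ((σ (j : ZMod (3 * m))).val : ℝ) + 1 ≤ 3 * m := by
    exact_mod_cast ZMod.val_lt (σ (j : ZMod (3 * m)))
  simp only [exchMul, permMap, fract01]
  rw [h2, h1, Int.cast_natCast, h3, Int.fract_eq_iff]
  refine ⟨by positivity, by rw [div_lt_one (by positivity)]; linarith, 0, ?_⟩
  push_cast
  field_simp
  ring

lemma gridCell_subset_image {m : ℕ} (hm : 0 < m) (σ : Equiv.Perm (ZMod (3 * m))) (p k : ℕ)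
    (hk : k < 3 * m * m ^ (p + 1)) :
    ∃ k' < 3 * m * m ^ p, gridCell m p k' ⊆ exchMul m σ '' gridCell m (p + 1) k := by
  have hm' : (0:ℝ) < m := by exact_mod_cast hm
  have : NeZero (3 * m) := ⟨by omega⟩
  set D := m ^ p with hD
  have hDpos : 0 < D := by positivity
  have hD' : (0:ℝ) < D := by exact_mod_cast hDpos
  set q := k / D with hq
  set l := k % D with hl
  have hlD : l < D := Nat.mod_lt _ hDpos
  have hlD' : (l:ℝ) + 1 ≤ D := by exact_mod_cast hlD
  have hkq : (k : ℝ) = D * q + l := by exact_mod_cast (Nat.div_add_mod k D).symm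
  set j := q % (3 * m) with hj
  set a := q / (3 * m) with ha
  have hqj : (q : ℝ) = 3 * m * a + j := by exact_mod_cast (Nat.div_add_mod q (3 * m)).symm
  have hjlt : j < 3 * m := Nat.mod_lt _ (by omega)
  have hv := ZMod.val_lt (σ (j : ZMod (3 * m)))
  refine ⟨l + (σ (j : ZMod (3 * m))).val * D, ?_, ?_⟩
  · nlinarith
  · rintro y ⟨s, hs0, hs1, hy⟩
    have hk' : (k : ℝ) + 1 ≤ 3 * m * m ^ (p + 1) := by exact_mod_cast hk
    refine ⟨⟨(k + s) / (3 * m * m ^ (p + 1)), by positivity, ?_⟩, ⟨s, hs0, hs1, rfl⟩, ?_⟩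
    · rw [div_lt_one (by positivity)]; linarith
    · apply Subtype.ext
      have hDR : (m:ℝ) ^ p = D := by rw [hD]; push_cast; rfl
      rw [exchMul_val hm σ (u := (l + s) / D) (by positivity)
        (by rw [div_lt_one hD']; linarith) hjlt a, hy, hDR]
      · push_cast
        field_simp
        ring
      · simp only [pow_succ, hDR, hkq, hqj]
        field_simp
        ring

lemma gridCell_zero_subset_image {m : ℕ} (hm : 0 < m) (σ : Equiv.Perm (ZMod (3 * m))) (j : ℕ)
    (hj : j < 3 * m) (a : ZMod (3 * m)) (ha : blockIdx m a = (j : ZMod 3)) :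
    gridCell m 0 (σ a).val ⊆ exchMul m σ '' gridCell m 0 j := by
  have hm' : (0:ℝ) < m := by exact_mod_cast hm
  have : NeZero (3 * m) := ⟨by omega⟩
  have hav := ZMod.val_lt a
  have hdiv : a.val / m = j % 3 := by
    rw [blockIdx, ZMod.natCast_eq_natCast_iff'] at ha
    rwa [Nat.mod_eq_of_lt] at ha
    exact Nat.div_lt_of_lt_mul (by linarith)
  set d := a.val % m with hd
  have hdm : (d : ℝ) + 1 ≤ m := by exact_mod_cast Nat.mod_lt a.val hm
  have hadm : (a.val : ℝ) = m * (j % 3 : ℕ) + d := by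
    rw [← hdiv]; exact_mod_cast (Nat.div_add_mod a.val m).symm
  have hjj : (j : ℝ) = 3 * (j / 3 : ℕ) + (j % 3 : ℕ) := by
    exact_mod_cast (Nat.div_add_mod j 3).symm
  have hj' : (j : ℝ) + 1 ≤ 3 * m := by exact_mod_cast hj
  rintro y ⟨s, hs0, hs1, hy⟩
  have hds : (d + s) / m < 1 := by rw [div_lt_one hm']; linarith
  refine ⟨⟨(j + (d + s) / m) / (3 * m), by positivity, ?_⟩,
    ⟨(d + s) / m, by positivity, hds, by simp⟩, ?_⟩
  · rw [div_lt_one (by positivity)]; linarith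
  · apply Subtype.ext
    rw [exchMul_val hm σ hs0 hs1 hav (j / 3), hy, ZMod.natCast_zmod_val]
    · simp [add_comm]
    · simp only [hadm]
      field_simp
      rw [hjj]
      ring

lemma exists_classOf_step {m : ℕ} (hm : 0 < m) (σ : Equiv.Perm (ZMod (3 * m)))
    (x : Set.Ico (0:ℝ) 1) :
    ∃ a, blockIdx m a = classOf m x ∧ resIdx m (σ a) = classOf m (exchMul m σ x) := by
  have hm' : (0:ℝ) < m := by exact_mod_cast hm
  have : NeZero (3 * m) := ⟨by omega⟩
  have hx0 : 0 ≤ x.val := x.2.1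
  set k := ⌊(3 * m : ℝ) * m * x.val⌋₊ with hk
  have hk0 : (k : ℝ) ≤ (3 * m : ℝ) * m * x.val := Nat.floor_le (by positivity)
  have hk1 : (3 * m : ℝ) * m * x.val < k + 1 := Nat.lt_floor_add_one _
  set j := k % (3 * m) with hj
  have hjlt : j < 3 * m := Nat.mod_lt _ (by omega)
  have hkj : (k : ℝ) = 3 * m * (k / (3 * m) : ℕ) + j := by
    exact_mod_cast (Nat.div_add_mod k (3 * m)).symm
  refine ⟨(j : ZMod (3 * m)), ?_, ?_⟩
  · have h1 : (3 * m : ℝ) * x.val = (3 * m : ℝ) * m * x.val / m := by field_simp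
    rw [blockIdx, classOf, h1, Nat.floor_div_natCast, ← hk, ZMod.val_cast_of_lt hjlt,
      ZMod.natCast_eq_natCast_iff', hj, mul_comm 3 m, Nat.mod_mul_right_div_self, Nat.mod_mod]
  · rw [resIdx, classOf, exchMul_val hm σ (u := 3 * m * m * x.val - k) (by linarith) (by linarith)
      hjlt (k / (3 * m)) (by rw [hkj]; field_simp; ring)]
    congr 2
    symm
    rw [Nat.floor_eq_iff (by apply mul_nonneg; positivity; apply div_nonneg _ (by positivity);
                             apply add_nonneg (by linarith); positivity)]
    rw [mul_div_cancel₀ _ (by positivity)]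
    constructor <;> linarith

lemma exists_gridCell_subset {m : ℕ} (hm : 2 ≤ m) {U : Set (Set.Ico (0:ℝ) 1)} (hU : IsOpen U)
    (hne : U.Nonempty) : ∃ p, ∃ k < 3 * m * m ^ p, gridCell m p k ⊆ U := by
  obtain ⟨x, hx⟩ := hne
  obtain ⟨ε, hε, hball⟩ := Metric.isOpen_iff.1 hU x hx
  have hm' : (1:ℝ) < m := by exact_mod_cast hm
  obtain ⟨p, hp⟩ := pow_unbounded_of_one_lt (1 / ε) hm'
  have hx0 : 0 ≤ x.val := x.2.1
  have hx1 : x.val < 1 := x.2.2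
  have hP : (0:ℝ) < 3 * m * m ^ p := by positivity
  have hεP : 1 < ε * (3 * m * m ^ p) := by
    rw [div_lt_iff₀ hε] at hp
    nlinarith [mul_pos hε (pow_pos (by linarith : (0:ℝ) < m) p)]
  set k := ⌊(3 * m * m ^ p : ℝ) * x.val⌋₊ with hk
  have hk0 : (k : ℝ) ≤ (3 * m * m ^ p : ℝ) * x.val := Nat.floor_le (by positivity)
  have hk1 : (3 * m * m ^ p : ℝ) * x.val < k + 1 := Nat.lt_floor_add_one _
  refine ⟨p, k, ?_, ?_⟩
  · have : (k : ℝ) < 3 * m * m ^ p := by nlinarith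
    exact_mod_cast this
  · rintro y ⟨s, hs0, hs1, hy⟩
    apply hball
    rw [Metric.mem_ball, Subtype.dist_eq, Real.dist_eq, hy]
    have : ((k + s) / (3 * m * m ^ p) - x.val : ℝ)
        = (k + s - 3 * m * m ^ p * x.val) / (3 * m * m ^ p) := by field_simp
    rw [this, abs_div, abs_of_pos hP, div_lt_iff₀ hP]
    refine lt_of_le_of_lt ?_ hεP
    rw [abs_le]
    constructor <;> linarith

lemma exists_gridCell_zero_subset_iterate {m : ℕ} (hm : 0 < m) (σ : Equiv.Perm (ZMod (3 * m)))
    (p k : ℕ) (hk : k < 3 * m * m ^ p) :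
    ∃ j < 3 * m, gridCell m 0 j ⊆ (exchMul m σ)^[p] '' gridCell m p k := by
  induction p generalizing k with
  | zero => exact ⟨k, by simpa using hk, by simp⟩
  | succ p ih =>
    obtain ⟨k', hk', hsub⟩ := gridCell_subset_image hm σ p k hk
    obtain ⟨j, hj, hj2⟩ := ih k' hk'
    refine ⟨j, hj, hj2.trans ?_⟩
    rw [Function.iterate_succ, Set.image_comp]
    exact Set.image_mono hsub

lemma exists_mem_gridCell_zero {m : ℕ} (hm : 0 < m) (y : Set.Ico (0:ℝ) 1) :
    ∃ i : ZMod (3 * m), y ∈ gridCell m 0 i.val := by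
  have hm' : (0:ℝ) < m := by exact_mod_cast hm
  have hy0 : 0 ≤ y.val := y.2.1
  have hy1 : y.val < 1 := y.2.2
  set k := ⌊(3 * m : ℝ) * y.val⌋₊ with hk
  have hk0 : (k : ℝ) ≤ (3 * m : ℝ) * y.val := Nat.floor_le (by positivity)
  have hk1 : (3 * m : ℝ) * y.val < k + 1 := Nat.lt_floor_add_one _
  have hklt : k < 3 * m := by
    have : (k : ℝ) < 3 * m := by nlinarith
    exact_mod_cast this
  refine ⟨(k : ZMod (3 * m)), 3 * m * y.val - k, by linarith, by linarith, ?_⟩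
  rw [ZMod.val_cast_of_lt hklt]
  field_simp
  ring

lemma card_fiber_eq {α : Type*} [Fintype α] {m : ℕ} (hα : Fintype.card α = 3 * m)
    (h : α → ZMod 3) (e : Equiv.Perm α) (he : ∀ a, h (e a) = h a + 1) (r : ZMod 3) :
    (Finset.univ.filter fun a => h a = r).card = m := by
  have key : ∀ r, (Finset.univ.filter fun a => h a = r).card
      = (Finset.univ.filter fun a => h a = r + 1).card := fun r =>
    Finset.card_equiv e (by intro a; simp [he])
  have hsum := Finset.card_eq_sum_card_fiberwise (f := h) (s := Finset.univ) (t := Finset.univ)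
    (by intro a _; simp)
  rw [Finset.card_univ, hα] at hsum
  have h3 : ∀ F : ZMod 3 → ℕ, ∑ b, F b = F 0 + F 1 + F 2 := fun F => Fin.sum_univ_three F
  rw [h3] at hsum
  have k0 := key 0
  have k1 := key 1
  rw [show (0 : ZMod 3) + 1 = 1 from rfl] at k0
  rw [show (1 : ZMod 3) + 1 = 2 from rfl] at k1
  have : r = 0 ∨ r = 1 ∨ r = 2 := by revert r; decide
  rcases this with rfl | rfl | rfl <;> omega

lemma resIdx_add_one {m : ℕ} (hm : 0 < m) (a : ZMod (3 * m)) :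
    resIdx m (a + 1) = resIdx m a + 1 := by
  have : NeZero (3 * m) := ⟨by omega⟩
  simp only [resIdx, ZMod.natCast_val]
  rw [ZMod.cast_add (dvd_mul_right 3 m), ZMod.cast_one (dvd_mul_right 3 m)]

lemma blockIdx_add {m : ℕ} (hm : 0 < m) (a : ZMod (3 * m)) :
    blockIdx m (a + (m : ZMod (3 * m))) = blockIdx m a + 1 := by
  have : NeZero (3 * m) := ⟨by omega⟩
  rw [blockIdx, blockIdx, ZMod.val_add, ZMod.val_cast_of_lt (by omega : m < 3 * m)]
  have h : (a.val + m) % (3 * m) / m = (a.val / m + 1) % 3 := by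
    rw [← Nat.add_div_right _ hm, ← Nat.mod_mul_right_div_self, mul_comm m 3]
  rw [h, ZMod.natCast_mod]
  push_cast
  rfl

lemma card_blockIdx {m : ℕ} (hm : 0 < m) [NeZero (3 * m)] (r : ZMod 3) :
    (Finset.univ.filter fun a => blockIdx m a = r).card = m :=
  card_fiber_eq (ZMod.card _) _ (Equiv.addRight (m : ZMod (3 * m))) (blockIdx_add hm) r

lemma card_resIdx {m : ℕ} (hm : 0 < m) [NeZero (3 * m)] (r : ZMod 3) :
    (Finset.univ.filter fun a => resIdx m a = r).card = m :=
  card_fiber_eq (ZMod.card _) _ (Equiv.addRight 1) (resIdx_add_one hm) r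

lemma card_resIdx_comp {m : ℕ} (hm : 0 < m) [NeZero (3 * m)] (σ : Equiv.Perm (ZMod (3 * m)))
    (r : ZMod 3) : (Finset.univ.filter fun a => resIdx m (σ a) = r).card = m := by
  exact (Finset.card_equiv σ (by intro a; simp)).trans (card_resIdx hm r)

lemma carries_of_block_imp {m : ℕ} (hm : 0 < m) {σ : Equiv.Perm (ZMod (3 * m))} {r s : ZMod 3}
    (h : ∀ a, blockIdx m a = r → resIdx m (σ a) = s) : Carries m σ r s := by
  have : NeZero (3 * m) := ⟨by omega⟩
  have := Finset.eq_of_subset_of_card_le (Finset.monotone_filter_right Finset.univ fun a _ => h a)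
    ((card_resIdx_comp hm σ s).trans (card_blockIdx hm r).symm).le
  intro a
  simpa using Finset.ext_iff.1 this a

lemma carries_of_res_imp {m : ℕ} (hm : 0 < m) {σ : Equiv.Perm (ZMod (3 * m))} {r s : ZMod 3}
    (h : ∀ a, resIdx m (σ a) = s → blockIdx m a = r) : Carries m σ r s := by
  have : NeZero (3 * m) := ⟨by omega⟩
  have := Finset.eq_of_subset_of_card_le (Finset.monotone_filter_right Finset.univ fun a _ => h a)
    ((card_blockIdx hm r).trans (card_resIdx_comp hm σ s).symm).le
  intro a
  simpa using (Finset.ext_iff.1 this a).symm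

lemma exists_blockIdx_eq {m : ℕ} (hm : 0 < m) (r : ZMod 3) : ∃ a, blockIdx m a = r := by
  have : NeZero (3 * m) := ⟨by omega⟩
  obtain ⟨a, ha⟩ := Finset.card_pos.1 (by rw [card_blockIdx hm r]; exact hm)
  exact ⟨a, by simpa using ha⟩

lemma exists_resIdx_eq {m : ℕ} (hm : 0 < m) (σ : Equiv.Perm (ZMod (3 * m))) (s : ZMod 3) :
    ∃ a, resIdx m (σ a) = s := by
  have : NeZero (3 * m) := ⟨by omega⟩
  obtain ⟨a, ha⟩ := Finset.card_pos.1 (by rw [card_resIdx_comp hm σ s]; exact hm)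
  exact ⟨a, by simpa using ha⟩

set_option synthInstance.maxHeartbeats 400000 in
set_option synthInstance.maxSize 4000 in
/-- A relation on three points having the support pattern of a doubly stochastic matrix, with no
fixed diagonal block and different from both three-cycles, is primitive. -/
lemma exists_path_five : ∀ t : ZMod 3 → ZMod 3 → Bool,
    (∀ r, ∃ s, t r s) →
    (∀ r s, (∀ s', t r s' → s' = s) → ∀ r', t r' s → r' = r) →
    (∀ r s, (∀ r', t r' s → r' = r) → ∀ s', t r s' → s' = s) →
    (∀ r, ∃ s, s ≠ r ∧ t r s) →
    (∃ r s, s ≠ r + 1 ∧ t r s) →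
    (∃ r s, s ≠ r + 2 ∧ t r s) →
    ∀ r s, ∃ a, t r a ∧ ∃ b, t a b ∧ ∃ c, t b c ∧ ∃ d, t c d ∧ t d s := by
  decide +kernel

/-- The permutations whose composition with multiplication by `m` fails to be mixing. -/
def Degenerate (m : ℕ) (σ : Equiv.Perm (ZMod (3 * m))) : Prop :=
  (∃ r, Carries m σ r r) ∨ (∀ r, Carries m σ r (r + 1)) ∨ (∀ r, Carries m σ r (r + 2))

lemma topMixing_of_not_degenerate {m : ℕ} (hm : 2 ≤ m) {σ : Equiv.Perm (ZMod (3 * m))}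
    (h : ¬ Degenerate m σ) : TopMixing (exchMul m σ) := by
  classical
  have hm0 : 0 < m := by omega
  have : NeZero (3 * m) := ⟨by omega⟩
  simp only [Degenerate, not_or, not_exists, not_forall] at h
  obtain ⟨hd0, ⟨r1, hd1⟩, ⟨r2, hd2⟩⟩ := h
  let T : ZMod 3 → ZMod 3 → Prop := fun r s => ∃ a, blockIdx m a = r ∧ resIdx m (σ a) = s
  have hesc : ∀ r s, ¬ Carries m σ r s → ∃ s', s' ≠ s ∧ T r s' := by
    intro r s hrs
    by_contra! hc
    refine hrs (carries_of_block_imp hm0 fun a ha => ?_)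
    by_contra hne
    exact hc _ hne ⟨a, ha, rfl⟩
  have hpath : ∀ r s, ∃ a, T r a ∧ ∃ b, T a b ∧ ∃ c, T b c ∧ ∃ d, T c d ∧ T d s := by
    have := exists_path_five (fun r s => decide (T r s))
    simp only [decide_eq_true_eq] at this
    apply this
    · intro r
      obtain ⟨a, ha⟩ := exists_blockIdx_eq hm0 r
      exact ⟨_, a, ha, rfl⟩
    · rintro r s hrs r' ⟨a, ha, has⟩
      have hc : Carries m σ r s :=
        carries_of_block_imp hm0 fun b hb => hrs _ ⟨b, hb, rfl⟩
      rw [← ha]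
      exact (hc a).2 has
    · rintro r s hrs s' ⟨a, ha, has⟩
      have hc : Carries m σ r s :=
        carries_of_res_imp hm0 fun b hb => hrs _ ⟨b, rfl, hb⟩
      rw [← has]
      exact (hc a).1 ha
    · exact fun r => hesc r r (hd0 r)
    · exact ⟨r1, hesc _ _ hd1⟩
    · exact ⟨r2, hesc _ _ hd2⟩
  have hstep : ∀ (S : Set (Set.Ico (0:ℝ) 1)) r s, T r s →
      (∃ i : ZMod (3 * m), resIdx m i = r ∧ gridCell m 0 i.val ⊆ S) →
      ∃ i : ZMod (3 * m), resIdx m i = s ∧ gridCell m 0 i.val ⊆ exchMul m σ '' S := by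
    rintro S r s ⟨a, har, has⟩ ⟨i, hir, hi⟩
    exact ⟨σ a, has, (gridCell_zero_subset_image hm0 σ i.val (ZMod.val_lt i) a
      (har.trans hir.symm)).trans (Set.image_mono hi)⟩
  have hcover : ∀ S : Set (Set.Ico (0:ℝ) 1),
      (∀ s, ∃ i : ZMod (3 * m), resIdx m i = s ∧ gridCell m 0 i.val ⊆ S) →
      exchMul m σ '' S = Set.univ := by
    intro S hS
    refine Set.eq_univ_of_forall fun y => ?_
    obtain ⟨i, hi⟩ := exists_mem_gridCell_zero hm0 y
    obtain ⟨j, hj, hjS⟩ := hS (blockIdx m (σ.symm i))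
    refine Set.image_mono hjS (gridCell_zero_subset_image hm0 σ j.val (ZMod.val_lt j)
      (σ.symm i) hj.symm ?_)
    simpa using hi
  have hsurj : Function.Surjective (exchMul m σ) := by
    rw [← Set.range_eq_univ, ← Set.image_univ]
    exact hcover _ fun s => by
      obtain ⟨i, hi⟩ := exists_resIdx_eq hm0 σ s
      exact ⟨_, hi, Set.subset_univ _⟩
  intro U V hU hV hUne hVne
  obtain ⟨p, k, hk, hkU⟩ := exists_gridCell_subset hm hU hUne
  obtain ⟨j, hj, hjsub⟩ := exists_gridCell_zero_subset_iterate hm0 σ p k hk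
  have hfull : (exchMul m σ)^[p + 6] '' U = Set.univ := by
    have hj0 : ∃ i : ZMod (3 * m), resIdx m i = (j : ZMod 3) ∧
        gridCell m 0 i.val ⊆ (exchMul m σ)^[p] '' U := by
      refine ⟨(j : ZMod (3 * m)), ?_, ?_⟩
      · rw [resIdx, ZMod.val_cast_of_lt hj]
      · rw [ZMod.val_cast_of_lt hj]
        exact hjsub.trans (Set.image_mono hkU)
    have hsucc : ∀ n, (exchMul m σ)^[n + 1] '' U = exchMul m σ '' ((exchMul m σ)^[n] '' U) := by
      intro n
      rw [Function.iterate_succ', Set.image_comp]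
    rw [hsucc (p + 5)]
    apply hcover
    intro s
    obtain ⟨a, ha, b, hb, c, hc, d, hd, he⟩ := hpath (j : ZMod 3) s
    rw [hsucc (p + 4), hsucc (p + 3), hsucc (p + 2), hsucc (p + 1), hsucc p]
    exact hstep _ _ _ he (hstep _ _ _ hd (hstep _ _ _ hc (hstep _ _ _ hb (hstep _ _ _ ha hj0))))
  refine ⟨p + 6, fun n hn => ?_⟩
  obtain ⟨q, rfl⟩ := Nat.exists_eq_add_of_le hn
  rw [add_comm, Function.iterate_add, Set.image_comp, hfull,
    Set.image_univ_of_surjective (hsurj.iterate q), Set.univ_inter]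
  exact hVne

lemma exists_open_classOf {m : ℕ} (hm : 0 < m) (r : ZMod 3) :
    ∃ U : Set (Set.Ico (0:ℝ) 1), IsOpen U ∧ U.Nonempty ∧ ∀ x ∈ U, classOf m x = r := by
  have hm' : (1:ℝ) ≤ m := by exact_mod_cast hm
  have hr : (r.val : ℝ) + 1 ≤ 3 := by exact_mod_cast ZMod.val_lt r
  refine ⟨{x | (r.val : ℝ) < 3 * m * x.val ∧ 3 * m * x.val < r.val + 1}, ?_, ?_, ?_⟩
  · exact (isOpen_lt continuous_const (continuous_const.mul continuous_subtype_val)).inter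
      (isOpen_lt (continuous_const.mul continuous_subtype_val) continuous_const)
  · refine ⟨⟨(r.val + 1 / 2) / (3 * m), by positivity, ?_⟩, ?_⟩
    · rw [div_lt_one (by positivity)]; linarith
    · have : (3 * m : ℝ) * ((r.val + 1 / 2) / (3 * m)) = r.val + 1 / 2 := by field_simp
      simp only [Set.mem_ofPred_eq, this]
      constructor <;> linarith
  · rintro x ⟨h1, h2⟩
    have : ⌊(3 * m : ℝ) * x.val⌋₊ = r.val := by
      rw [Nat.floor_eq_iff (by have := x.2.1; positivity)]
      exact ⟨h1.le, h2⟩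
    rw [classOf, this, ZMod.natCast_zmod_val]

lemma not_topMixing_of_degenerate {m : ℕ} (hm : 0 < m) {σ : Equiv.Perm (ZMod (3 * m))}
    (h : Degenerate m σ) : ¬ TopMixing (exchMul m σ) := by
  intro hmix
  have hstep : ∀ {r s x}, Carries m σ r s → classOf m x = r → classOf m (exchMul m σ x) = s := by
    intro r s x hc hx
    obtain ⟨a, ha, hb⟩ := exists_classOf_step hm σ x
    rw [← hb]
    exact (hc a).1 (ha.trans hx)
  have hrot : ∀ t, (∀ r, Carries m σ r (r + t)) → ∀ n x,
      classOf m ((exchMul m σ)^[n] x) = classOf m x + n * t := by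
    intro t ht n x
    induction n with
    | zero => simp
    | succ n ih =>
      rw [Function.iterate_succ_apply', hstep (ht _) rfl, ih]
      push_cast
      ring
  have hex : ∃ r, ∀ x, classOf m x = r → ∀ n, classOf m ((exchMul m σ)^[3 * n] x) = r := by
    rcases h with ⟨r, hr⟩ | h | h
    · refine ⟨r, fun x hx n => ?_⟩
      induction 3 * n with
      | zero => exact hx
      | succ k ih =>
        rw [Function.iterate_succ_apply']
        exact hstep hr ih
    all_goals
      refine ⟨0, fun x hx n => ?_⟩
      rw [hrot _ h, hx]
      push_cast
      rw [show (3 : ZMod 3) = 0 from rfl]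
      ring
  obtain ⟨r, hr⟩ := hex
  obtain ⟨U, hU, hUne, hUr⟩ := exists_open_classOf hm r
  obtain ⟨V, hV, hVne, hVr⟩ := exists_open_classOf hm (r + 1)
  obtain ⟨n₀, hn⟩ := hmix U V hU hV hUne hVne
  obtain ⟨_, ⟨x, hx, rfl⟩, hxV⟩ := hn (3 * n₀) (by omega)
  have h1 := hVr _ hxV
  rw [hr x (hUr x hx)] at h1
  exact absurd h1 ((by decide : ∀ r : ZMod 3, r ≠ r + 1) r)

/-- A bijection carrying `p` onto `q` is a bijection between `p` and `q` together with one between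
their complements. -/
def permCarryEquiv {α : Type*} (p q : α → Prop) [DecidablePred p] [DecidablePred q] :
    {σ : Equiv.Perm α // ∀ a, p a ↔ q (σ a)} ≃
      ({a // p a} ≃ {a // q a}) × ({a // ¬ p a} ≃ {a // ¬ q a}) where
  toFun σ := (σ.1.subtypeEquiv σ.2, σ.1.subtypeEquiv fun a => not_congr (σ.2 a))
  invFun e := ⟨Equiv.subtypeCongr e.1 e.2, fun a => by
    by_cases h : p a
    · simp [Equiv.subtypeCongr, h, Equiv.sumCompl_symm_apply_of_pos, (e.1 ⟨a, h⟩).2]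
    · simp [Equiv.subtypeCongr, h, Equiv.sumCompl_symm_apply_of_neg, (e.2 ⟨a, h⟩).2]⟩
  left_inv σ := by
    ext a
    by_cases h : p a <;> simp [Equiv.subtypeCongr, h]
  right_inv e := by
    refine Prod.ext ?_ ?_
    · ext ⟨a, h⟩
      simp [Equiv.subtypeCongr, h]
    · ext ⟨a, h⟩
      simp [Equiv.subtypeCongr, h]

open Classical in
lemma card_carries {m : ℕ} (hm : 0 < m) [NeZero (3 * m)] (r s : ZMod 3) :
    (Finset.univ.filter fun σ => Carries m σ r s).card = (2 * m).factorial * m.factorial := by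
  have hb : Fintype.card {a // blockIdx m a = r} = m := by
    rw [Fintype.card_subtype, card_blockIdx hm]
  have hs : Fintype.card {a // resIdx m a = s} = m := by
    rw [Fintype.card_subtype, card_resIdx hm]
  have hb' : Fintype.card {a // ¬ blockIdx m a = r} = 2 * m := by
    rw [Fintype.card_subtype_compl, hb, ZMod.card]; omega
  have hs' : Fintype.card {a // ¬ resIdx m a = s} = 2 * m := by
    rw [Fintype.card_subtype_compl, hs, ZMod.card]; omega
  rw [← Fintype.card_subtype]
  let e : {σ // Carries m σ r s} ≃ _ :=
    permCarryEquiv (fun a => blockIdx m a = r) fun a => resIdx m a = s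
  rw [Fintype.card_congr e]
  rw [Fintype.card_prod, Fintype.card_equiv (Fintype.equivOfCardEq (hb.trans hs.symm)),
    Fintype.card_equiv (Fintype.equivOfCardEq (hb'.trans hs'.symm)), hb, hb', mul_comm]

open Classical in
lemma card_carries_shift {m : ℕ} (hm : 0 < m) [NeZero (3 * m)] (t : ZMod 3) :
    (Finset.univ.filter fun σ => ∀ r, Carries m σ r (r + t)).card
      = (Finset.univ.filter fun σ => ∀ r, Carries m σ r (r + (t + 1))).card := by
  refine Finset.card_equiv (Equiv.mulLeft (Equiv.addRight 1)) fun σ => ?_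
  rw [Finset.mem_filter, Finset.mem_filter]
  simp [Carries, resIdx_add_one hm, ← add_assoc]

lemma Carries.unique {m : ℕ} (hm : 0 < m) {σ : Equiv.Perm (ZMod (3 * m))} {r s s' : ZMod 3}
    (h : Carries m σ r s) (h' : Carries m σ r s') : s = s' := by
  obtain ⟨a, ha⟩ := exists_blockIdx_eq hm r
  rw [← (h a).1 ha, ← (h' a).1 ha]

lemma Carries.all_of_two {m : ℕ} {σ : Equiv.Perm (ZMod (3 * m))} {r s : ZMod 3} (hrs : r ≠ s)
    (h : Carries m σ r r) (h' : Carries m σ s s) (q : ZMod 3) : Carries m σ q q := by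
  have key : ∀ r s q x y : ZMod 3, r ≠ s → (x = r ↔ y = r) → (x = s ↔ y = s) →
      (x = q ↔ y = q) := by decide
  exact fun a => key r s q _ _ hrs (h a) (h' a)

open Classical in
lemma card_degenerate {m : ℕ} (hm : 0 < m) [NeZero (3 * m)] :
    (Finset.univ.filter fun σ => Degenerate m σ).card
      = 3 * (2 * m).factorial * m.factorial := by
  set A : ZMod 3 → Finset (Equiv.Perm (ZMod (3 * m))) :=
    fun r => Finset.univ.filter fun σ => Carries m σ r r with hA
  set E : ZMod 3 → Finset (Equiv.Perm (ZMod (3 * m))) :=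
    fun t => Finset.univ.filter fun σ => ∀ r, Carries m σ r (r + t) with hE
  have hAc : ∀ r, (A r).card = (2 * m).factorial * m.factorial := fun r => card_carries hm r r
  have hE1 : (E 0).card = (E 1).card := card_carries_shift hm 0
  have hE2 : (E 1).card = (E 2).card := card_carries_shift hm 1
  have hsplit : (Finset.univ.filter fun σ => Degenerate m σ)
      = ((A 0 ∪ A 1) ∪ A 2) ∪ (E 1 ∪ E 2) := by
    ext σ
    have : (∃ r, Carries m σ r r) ↔
        (Carries m σ 0 0 ∨ Carries m σ 1 1) ∨ Carries m σ 2 2 := by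
      rw [or_assoc]
      exact Fin.exists_fin_succ.trans (or_congr Iff.rfl
        (Fin.exists_fin_two (p := fun i => Carries m σ (Fin.succ i) (Fin.succ i))))
    rw [Finset.mem_filter]
    simp only [hA, hE, Finset.mem_union, Finset.mem_filter, Finset.mem_univ, true_and, Degenerate,
      this]
  have h01 : A 0 ∩ A 1 = E 0 := by
    ext σ
    simp only [hA, hE, Finset.mem_inter, Finset.mem_filter, Finset.mem_univ, true_and, add_zero]
    exact ⟨fun h => Carries.all_of_two (by decide) h.1 h.2, fun h => ⟨h 0, h 1⟩⟩
  have h012 : (A 0 ∪ A 1) ∩ A 2 = E 0 := by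
    ext σ
    simp only [hA, hE, Finset.mem_inter, Finset.mem_union, Finset.mem_filter, Finset.mem_univ,
      true_and, add_zero]
    refine ⟨?_, fun h => ⟨Or.inl (h 0), h 2⟩⟩
    rintro ⟨h | h, h2⟩
    · exact Carries.all_of_two (by decide) h h2
    · exact Carries.all_of_two (by decide) h h2
  have hE12 : Disjoint (E 1) (E 2) := by
    rw [Finset.disjoint_left]
    intro σ h1 h2
    simp only [hE, Finset.mem_filter, Finset.mem_univ, true_and] at h1 h2
    exact absurd ((h1 0).unique hm (h2 0)) (by decide)
  have hAE : Disjoint ((A 0 ∪ A 1) ∪ A 2) (E 1 ∪ E 2) := by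
    have key : ∀ r t, t ≠ 0 → Disjoint (A r) (E t) := by
      intro r t ht
      rw [Finset.disjoint_left]
      intro σ h1 h2
      simp only [hA, hE, Finset.mem_filter, Finset.mem_univ, true_and] at h1 h2
      exact ht (by simpa using h1.unique hm (h2 r))
    simp only [Finset.disjoint_union_left, Finset.disjoint_union_right]
    have k1 := fun r => key r 1 (by decide)
    have k2 := fun r => key r 2 (by decide)
    simp only [k1, k2, and_self]
  rw [hsplit, Finset.card_union_of_disjoint hAE, Finset.card_union_of_disjoint hE12]
  have c1 := Finset.card_union_add_card_inter (A 0) (A 1)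
  have c2 := Finset.card_union_add_card_inter (A 0 ∪ A 1) (A 2)
  rw [h01, hAc, hAc] at c1
  rw [h012, hAc] at c2
  rw [mul_assoc]
  omega

/-- for `N = 3m`, exactly `3·(2m)!·m!` permutations give a non-mixing
composition; equivalently the proportion is `1 / C(3m−1, 2m)`. -/
theorem stmt9 (m : ℕ) (hm : 2 ≤ m) :
    {σ : Equiv.Perm (ZMod (3 * m)) |
        ¬ TopMixing (fun x => permMap (3 * m) σ (mulMap m x))}.ncard
      = 3 * (2 * m).factorial * m.factorial ∧
    ({σ : Equiv.Perm (ZMod (3 * m)) |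
        ¬ TopMixing (fun x => permMap (3 * m) σ (mulMap m x))}.ncard : ℝ)
        / ((3 * m).factorial : ℝ)
      = (((3 * m - 1).choose (2 * m) : ℝ))⁻¹ := by
  have hm0 : 0 < m := by omega
  have : NeZero (3 * m) := ⟨by omega⟩
  have hcard : {σ : Equiv.Perm (ZMod (3 * m)) |
      ¬ TopMixing (fun x => permMap (3 * m) σ (mulMap m x))}.ncard
      = 3 * (2 * m).factorial * m.factorial := by
    classical
    rw [← card_degenerate hm0, ← Set.ncard_coe_finset]
    congr 1
    ext σ
    simp only [Set.mem_ofPred_eq, Finset.coe_filter, Finset.mem_univ, true_and]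
    constructor
    · exact fun h => by_contra fun hd => h (topMixing_of_not_degenerate hm hd)
    · exact not_topMixing_of_degenerate hm0
  refine ⟨hcard, ?_⟩
  rw [hcard]
  have h1 := Nat.choose_mul_factorial_mul_factorial (show 2 * m ≤ 3 * m - 1 by omega)
  rw [show 3 * m - 1 - 2 * m = m - 1 by omega] at h1
  have h2 := Nat.mul_factorial_pred hm0.ne'
  have h3 := Nat.mul_factorial_pred (show 3 * m ≠ 0 by omega)
  have hC : ((3 * m - 1).choose (2 * m) : ℝ) ≠ 0 := by
    exact_mod_cast (Nat.choose_pos (by omega)).ne'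
  rw [div_eq_iff (by positivity), inv_mul_eq_div, eq_div_iff hC]
  norm_cast
  rw [← h3, ← h1, ← h2]
  ring
end

section
/- Let m ≥ 2 and N = 4m. The proportion p(4,m) of permutations σ of ℤ/Nℤ (among all N! permutations) for which σ ∘ f is not topologically mixing is given by p(4,m) = [ 4·(3m)!/(m!·m!·m!) + 6·C(2m,m)² − 12·C(2m,m) ] · (m!)⁴ / (4m)!, where C(2m,m) is the binomial coefficient. -/
open Set

namespace QuarterMixing

/-- The permutations `τ` of `Fin 4 × Fin m` that intertwine the labels `h ∘ π` of the source
blocks with the labels `h` of the target blocks. -/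
def Intertwines {m : ℕ} (h : Fin 4 → Fin 4) (π : Equiv.Perm (Fin 4))
    (τ : Equiv.Perm (Fin 4 × Fin m)) : Prop :=
  ∀ x, h (τ x).1 = h (π x.1)

instance {m : ℕ} (h : Fin 4 → Fin 4) (π : Equiv.Perm (Fin 4))
    (τ : Equiv.Perm (Fin 4 × Fin m)) : Decidable (Intertwines h π τ) :=
  inferInstanceAs (Decidable (∀ _, _))

theorem card_intertwines (m : ℕ) (h : Fin 4 → Fin 4) (π : Equiv.Perm (Fin 4)) :
    ((Finset.univ : Finset (Equiv.Perm (Fin 4 × Fin m))).filter (Intertwines h π)).card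
      = ∏ i : Fin 4, ((Finset.univ.filter fun r => h r = i).card * m).factorial := by
  classical
  have key := DomMulAct.stabilizer_card (fun x : Fin 4 × Fin m => h x.1)
  have hfib : ∀ i : Fin 4, Fintype.card {x : Fin 4 × Fin m // h x.1 = i}
      = (Finset.univ.filter fun r => h r = i).card * m := by
    intro i
    rw [Fintype.card_subtype]
    have : (Finset.univ.filter fun x : Fin 4 × Fin m => h x.1 = i)
        = (Finset.univ.filter fun r => h r = i) ×ˢ (Finset.univ : Finset (Fin m)) := by
      ext x; simp
    rw [this, Finset.card_product, Finset.card_fin]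
  simp only [hfib] at key
  rw [← key, Fintype.card_subtype]
  let e : Equiv.Perm (Fin 4 × Fin m) := π.prodCongr (Equiv.refl _)
  refine Finset.card_bij' (fun τ _ => τ * e⁻¹) (fun τ _ => τ * e) ?_ ?_ ?_ ?_
  · intro τ hτ
    simp only [Finset.mem_filter, Finset.mem_univ, true_and] at hτ ⊢
    funext x
    have := hτ (e⁻¹ x)
    have h2 : π (e⁻¹ x).1 = x.1 := by
      have : (e (e⁻¹ x)).1 = x.1 := by simp
      exact this
    rw [h2] at this
    simpa using this
  · intro τ hτ
    simp only [Finset.mem_filter, Finset.mem_univ, true_and] at hτ ⊢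
    intro x
    have := congrFun hτ (e x)
    simpa [e] using this
  · intro τ _; simp
  · intro τ _; simp

/-- The indicator of the point `s`. -/
def pointLabel (s r : Fin 4) : Fin 4 := if r = s then 1 else 0

/-- The indicator of the pair `{0, t}`. -/
def pairLabel (t r : Fin 4) : Fin 4 := if r = 0 ∨ r = t then 1 else 0

/-- The label separating `s`, `t` and the complement of `{s, t}`. -/
def twoPointLabel (s t r : Fin 4) : Fin 4 := if r = s then 1 else if r = t then 2 else 0

/-- The elements of the Klein four-group, `klein t` being the one that exchanges `0` and `t`. -/
def klein : Fin 4 → Equiv.Perm (Fin 4) :=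
  ![1, Equiv.swap 0 1 * Equiv.swap 2 3, Equiv.swap 0 2 * Equiv.swap 1 3,
    Equiv.swap 0 3 * Equiv.swap 1 2]

/-- `τ` preserves a point, preserves a partition into two pairs, or exchanges two complementary
pairs. -/
def Degenerate {m : ℕ} (τ : Equiv.Perm (Fin 4 × Fin m)) : Prop :=
  (∃ s, Intertwines (pointLabel s) 1 τ) ∨ Intertwines (pairLabel 1) 1 τ ∨
  Intertwines (pairLabel 2) 1 τ ∨ Intertwines (pairLabel 3) 1 τ ∨
  Intertwines (pairLabel 1) (klein 2) τ ∨ Intertwines (pairLabel 2) (klein 3) τ ∨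
  Intertwines (pairLabel 3) (klein 1) τ

instance {m : ℕ} (τ : Equiv.Perm (Fin 4 × Fin m)) : Decidable (Degenerate τ) :=
  inferInstanceAs (Decidable (_ ∨ _))

set_option maxRecDepth 100000 in
set_option synthInstance.maxHeartbeats 4000000 in
set_option synthInstance.maxSize 100000 in
set_option maxHeartbeats 4000000 in
theorem inclusion_exclusion_bool : ∀ b₁ b₂ b₃ c₁ c₂ c₃ : Bool,
    (b₁ && b₂) = (b₁ && b₃) → (b₁ && b₂) = (b₂ && b₃) → (b₁ && c₁) = false →
    (b₂ && c₂) = false → (b₃ && c₃) = false → (b₁ && c₂) = (b₁ && c₃) → (b₁ && c₂) = (c₂ && c₃) →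
    (b₂ && c₁) = (b₂ && c₃) → (b₂ && c₁) = (c₁ && c₃) → (b₃ && c₁) = (b₃ && c₂) →
    (b₃ && c₁) = (c₁ && c₂) → ∀ a₀ a₁ a₂ a₃ : Bool,
    (a₀ && a₁) = (a₀ && b₁) → (a₀ && a₁) = (a₁ && b₁) →
    (a₂ && a₃) = (a₂ && b₁) → (a₂ && a₃) = (a₃ && b₁) →
    (a₀ && a₂) = (a₀ && b₂) → (a₀ && a₂) = (a₂ && b₂) →
    (a₁ && a₃) = (a₁ && b₂) → (a₁ && a₃) = (a₃ && b₂) →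
    (a₀ && a₃) = (a₀ && b₃) → (a₀ && a₃) = (a₃ && b₃) →
    (a₁ && a₂) = (a₁ && b₃) → (a₁ && a₂) = (a₂ && b₃) →
    ((b₁ && b₂) = true → (a₀ && a₁ && a₂ && a₃) = true) →
    ((a₀ || a₁ || a₂ || a₃) = true → (c₁ || c₂ || c₃) = false) →
    (a₀ || a₁ || a₂ || a₃ || b₁ || b₂ || b₃ || c₁ || c₂ || c₃).toNat
      + 2 * ((a₀ && a₁).toNat + (a₀ && a₂).toNat + (a₀ && a₃).toNat + (a₁ && a₂).toNat
        + (a₁ && a₃).toNat + (a₂ && a₃).toNat)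
      + 2 * ((b₁ && c₂).toNat + (b₂ && c₁).toNat + (b₃ && c₁).toNat)
      = a₀.toNat + a₁.toNat + a₂.toNat + a₃.toNat + (b₁.toNat + b₂.toNat + b₃.toNat)
        + (c₁.toNat + c₂.toNat + c₃.toNat) + 6 * (b₁ && b₂).toNat := by
  decide

theorem decide_degenerate {m : ℕ} [NeZero m] (τ : Equiv.Perm (Fin 4 × Fin m)) :
    (decide (Degenerate τ)).toNat
      + 2 * ((decide (Intertwines (twoPointLabel 0 1) 1 τ)).toNat
        + (decide (Intertwines (twoPointLabel 0 2) 1 τ)).toNat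
        + (decide (Intertwines (twoPointLabel 0 3) 1 τ)).toNat
        + (decide (Intertwines (twoPointLabel 1 2) 1 τ)).toNat
        + (decide (Intertwines (twoPointLabel 1 3) 1 τ)).toNat
        + (decide (Intertwines (twoPointLabel 2 3) 1 τ)).toNat)
      + 2 * ((decide (Intertwines id (klein 1) τ)).toNat
        + (decide (Intertwines id (klein 2) τ)).toNat
        + (decide (Intertwines id (klein 3) τ)).toNat)
      = (decide (Intertwines (pointLabel 0) 1 τ)).toNat
        + (decide (Intertwines (pointLabel 1) 1 τ)).toNat
        + (decide (Intertwines (pointLabel 2) 1 τ)).toNat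
        + (decide (Intertwines (pointLabel 3) 1 τ)).toNat
        + ((decide (Intertwines (pairLabel 1) 1 τ)).toNat
        + (decide (Intertwines (pairLabel 2) 1 τ)).toNat
        + (decide (Intertwines (pairLabel 3) 1 τ)).toNat)
        + ((decide (Intertwines (pairLabel 1) (klein 2) τ)).toNat
        + (decide (Intertwines (pairLabel 2) (klein 3) τ)).toNat
        + (decide (Intertwines (pairLabel 3) (klein 1) τ)).toNat)
        + 6 * (decide (Intertwines id 1 τ)).toNat := by
  have iff_and : ∀ {h₁ h₂ h₃ : Fin 4 → Fin 4} {π₁ π₂ π₃ : Equiv.Perm (Fin 4)},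
      (∀ r s, (h₁ s = h₁ (π₁ r) ∧ h₂ s = h₂ (π₂ r)) ↔ h₃ s = h₃ (π₃ r)) →
      (decide (Intertwines h₁ π₁ τ) && decide (Intertwines h₂ π₂ τ))
        = decide (Intertwines h₃ π₃ τ) := by
    intro h₁ h₂ h₃ π₁ π₂ π₃ H
    rw [← Bool.decide_and, decide_eq_decide]
    exact ⟨fun h x => (H _ _).1 ⟨h.1 x, h.2 x⟩,
      fun h => ⟨fun x => ((H _ _).2 (h x)).1, fun x => ((H _ _).2 (h x)).2⟩⟩
  have not_and : ∀ {h₁ h₂ : Fin 4 → Fin 4} {π₁ π₂ : Equiv.Perm (Fin 4)},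
      (∃ r, ∀ s, ¬ (h₁ s = h₁ (π₁ r) ∧ h₂ s = h₂ (π₂ r))) →
      (decide (Intertwines h₁ π₁ τ) && decide (Intertwines h₂ π₂ τ)) = false := by
    rintro h₁ h₂ π₁ π₂ ⟨r, hr⟩
    rw [← Bool.decide_and, decide_eq_false_iff_not]
    exact fun h => hr _ ⟨h.1 (r, 0), h.2 (r, 0)⟩
  have hD : decide (Degenerate τ) = (decide (Intertwines (pointLabel 0) 1 τ)
      || decide (Intertwines (pointLabel 1) 1 τ) || decide (Intertwines (pointLabel 2) 1 τ)
      || decide (Intertwines (pointLabel 3) 1 τ) || decide (Intertwines (pairLabel 1) 1 τ)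
      || decide (Intertwines (pairLabel 2) 1 τ) || decide (Intertwines (pairLabel 3) 1 τ)
      || decide (Intertwines (pairLabel 1) (klein 2) τ)
      || decide (Intertwines (pairLabel 2) (klein 3) τ)
      || decide (Intertwines (pairLabel 3) (klein 1) τ)) := by
    rw [Bool.eq_iff_iff]
    simp only [Degenerate, decide_eq_true_eq, Bool.or_eq_true, or_assoc, Fin.exists_fin_succ,
      Fin.exists_fin_zero]
    simp
  have and_eq : ∀ {h₁ h₂ h₃ h₄ : Fin 4 → Fin 4} {π₁ π₂ π₃ π₄ : Equiv.Perm (Fin 4)},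
      (∀ r s, (h₁ s = h₁ (π₁ r) ∧ h₂ s = h₂ (π₂ r)) ↔ (h₃ s = h₃ (π₃ r) ∧ h₄ s = h₄ (π₄ r))) →
      (decide (Intertwines h₁ π₁ τ) && decide (Intertwines h₂ π₂ τ))
        = (decide (Intertwines h₃ π₃ τ) && decide (Intertwines h₄ π₄ τ)) := by
    intro h₁ h₂ h₃ h₄ π₁ π₂ π₃ π₄ H
    rw [← Bool.decide_and, ← Bool.decide_and, decide_eq_decide]
    exact ⟨fun h => ⟨fun x => ((H _ _).1 ⟨h.1 x, h.2 x⟩).1, fun x => ((H _ _).1 ⟨h.1 x, h.2 x⟩).2⟩,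
      fun h => ⟨fun x => ((H _ _).2 ⟨h.1 x, h.2 x⟩).1, fun x => ((H _ _).2 ⟨h.1 x, h.2 x⟩).2⟩⟩
  have key := inclusion_exclusion_bool
    (decide (Intertwines (pairLabel 1) 1 τ))
    (decide (Intertwines (pairLabel 2) 1 τ))
    (decide (Intertwines (pairLabel 3) 1 τ))
    (decide (Intertwines (pairLabel 1) (klein 2) τ))
    (decide (Intertwines (pairLabel 2) (klein 3) τ))
    (decide (Intertwines (pairLabel 3) (klein 1) τ))
    (and_eq (by decide)) (and_eq (by decide)) (not_and (by decide)) (not_and (by decide))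
    (not_and (by decide)) (and_eq (by decide)) (and_eq (by decide)) (and_eq (by decide))
    (and_eq (by decide)) (and_eq (by decide)) (and_eq (by decide))
    (decide (Intertwines (pointLabel 0) 1 τ))
    (decide (Intertwines (pointLabel 1) 1 τ))
    (decide (Intertwines (pointLabel 2) 1 τ))
    (decide (Intertwines (pointLabel 3) 1 τ))
    (and_eq (by decide)) (and_eq (by decide)) (and_eq (by decide)) (and_eq (by decide))
    (and_eq (by decide)) (and_eq (by decide)) (and_eq (by decide)) (and_eq (by decide))
    (and_eq (by decide)) (and_eq (by decide)) (and_eq (by decide)) (and_eq (by decide))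
    (by
      intro h
      simp only [Bool.and_eq_true, decide_eq_true_eq] at h ⊢
      have H : ∀ r s, (pairLabel 1 s = pairLabel 1 ((1 : Equiv.Perm (Fin 4)) r)) →
          (pairLabel 2 s = pairLabel 2 ((1 : Equiv.Perm (Fin 4)) r)) → s = r := by decide
      have hτ : ∀ x, (τ x).1 = x.1 := fun x => H _ _ (h.1 x) (h.2 x)
      simp [Intertwines, hτ])
    (by
      have nand : ∀ {a b : Bool}, (a && b) = false → a = true → b = false := by decide
      simp only [Bool.or_eq_true, Bool.or_eq_false_iff]
      rintro (((h | h) | h) | h) <;>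
        exact ⟨⟨nand (not_and (by decide)) h, nand (not_and (by decide)) h⟩,
          nand (not_and (by decide)) h⟩)
  rw [← hD, iff_and (h₃ := twoPointLabel 0 1) (π₃ := 1) (by decide),
    iff_and (h₃ := twoPointLabel 0 2) (π₃ := 1) (by decide),
    iff_and (h₃ := twoPointLabel 0 3) (π₃ := 1) (by decide),
    iff_and (h₃ := twoPointLabel 1 2) (π₃ := 1) (by decide),
    iff_and (h₃ := twoPointLabel 1 3) (π₃ := 1) (by decide),
    iff_and (h₃ := twoPointLabel 2 3) (π₃ := 1) (by decide),
    iff_and (h₃ := id) (π₃ := klein 1) (by decide),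
    iff_and (h₃ := id) (π₃ := klein 2) (by decide),
    iff_and (h₃ := id) (π₃ := klein 3) (by decide),
    iff_and (h₃ := id) (π₃ := 1) (by decide)] at key
  exact key

theorem card_degenerate (m : ℕ) [NeZero m] :
    ((Finset.univ : Finset (Equiv.Perm (Fin 4 × Fin m))).filter Degenerate).card
      + 12 * ((2 * m).factorial * m.factorial ^ 2)
      = 4 * (m.factorial * (3 * m).factorial) + 6 * (2 * m).factorial ^ 2 := by
  have hcard : ∀ p : Equiv.Perm (Fin 4 × Fin m) → Prop, ∀ [DecidablePred p],
      (Finset.univ.filter p).card = ∑ τ, (decide (p τ)).toNat := by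
    intro p _
    rw [Finset.card_filter]
    refine Finset.sum_congr rfl fun τ _ => ?_
    by_cases h : p τ <;> simp [h]
  have key := Finset.sum_congr (rfl : (Finset.univ : Finset (Equiv.Perm (Fin 4 × Fin m))) = _)
    fun τ _ => decide_degenerate τ
  simp only [Finset.sum_add_distrib, ← Finset.mul_sum, ← hcard] at key
  simp only [card_intertwines, Fin.prod_univ_four] at key
  simp only [show ∀ s i, (Finset.univ.filter fun r => pointLabel s r = i).card
      = (![3, 1, 0, 0] : Fin 4 → ℕ) i by decide,
    show (Finset.univ.filter fun r => pairLabel 1 r = 0).card = 2 by decide,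
    show (Finset.univ.filter fun r => pairLabel 1 r = 1).card = 2 by decide,
    show (Finset.univ.filter fun r => pairLabel 1 r = 2).card = 0 by decide,
    show (Finset.univ.filter fun r => pairLabel 1 r = 3).card = 0 by decide,
    show (Finset.univ.filter fun r => pairLabel 2 r = 0).card = 2 by decide,
    show (Finset.univ.filter fun r => pairLabel 2 r = 1).card = 2 by decide,
    show (Finset.univ.filter fun r => pairLabel 2 r = 2).card = 0 by decide,
    show (Finset.univ.filter fun r => pairLabel 2 r = 3).card = 0 by decide,
    show (Finset.univ.filter fun r => pairLabel 3 r = 0).card = 2 by decide,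
    show (Finset.univ.filter fun r => pairLabel 3 r = 1).card = 2 by decide,
    show (Finset.univ.filter fun r => pairLabel 3 r = 2).card = 0 by decide,
    show (Finset.univ.filter fun r => pairLabel 3 r = 3).card = 0 by decide,
    show ∀ i, (Finset.univ.filter fun r : Fin 4 => id r = i).card = 1 by decide] at key
  have h2 : ∀ s t : Fin 4, s ≠ t → ∀ i, (Finset.univ.filter fun r => twoPointLabel s t r = i).card
      = (![2, 1, 1, 0] : Fin 4 → ℕ) i := by decide
  simp only [h2 0 1 (by decide), h2 0 2 (by decide), h2 0 3 (by decide), h2 1 2 (by decide),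
    h2 1 3 (by decide), h2 2 3 (by decide)] at key
  simp at key
  ring_nf at key ⊢
  omega

/-- `h ∘ π` labels the source and `h` labels the target of every edge of `E` in the same way. -/
def LabelledBy (E : Fin 4 → Fin 4 → Prop) (h : Fin 4 → Fin 4) (π : Equiv.Perm (Fin 4)) : Prop :=
  ∀ r q, E r q → h q = h (π r)

instance (E : Fin 4 → Fin 4 → Prop) [∀ r q, Decidable (E r q)] (h : Fin 4 → Fin 4)
    (π : Equiv.Perm (Fin 4)) : Decidable (LabelledBy E h π) :=
  inferInstanceAs (Decidable (∀ _, _))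

/-- The analogue of `Degenerate` for relations on `Fin 4`. -/
def DegenerateRel (E : Fin 4 → Fin 4 → Prop) : Prop :=
  (∃ s, LabelledBy E (pointLabel s) 1) ∨ LabelledBy E (pairLabel 1) 1 ∨
  LabelledBy E (pairLabel 2) 1 ∨ LabelledBy E (pairLabel 3) 1 ∨
  LabelledBy E (pairLabel 1) (klein 2) ∨ LabelledBy E (pairLabel 2) (klein 3) ∨
  LabelledBy E (pairLabel 3) (klein 1)

instance (E : Fin 4 → Fin 4 → Prop) [∀ r q, Decidable (E r q)] : Decidable (DegenerateRel E) :=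
  inferInstanceAs (Decidable (_ ∨ _))

set_option maxRecDepth 100000 in
set_option maxHeartbeats 4000000 in
theorem degenerateRel_of_points : ∀ s₀ s₁ s₂ s₃ : Fin 4,
    (∀ r, ∃ q, (r = s₀ ↔ q = s₁) ∧ (r = s₁ ↔ q = s₂) ∧ (r = s₂ ↔ q = s₃)) →
    DegenerateRel fun r q => (r = s₀ ↔ q = s₁) ∧ (r = s₁ ↔ q = s₂) ∧ (r = s₂ ↔ q = s₃) := by
  decide

set_option maxRecDepth 100000 in
set_option maxHeartbeats 4000000 in
theorem degenerateRel_of_pairs : ∀ a₀ b₀ : Fin 4, a₀ < b₀ → ∀ a₁ b₁ : Fin 4, a₁ < b₁ →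
    ∀ a₂ b₂ : Fin 4, a₂ < b₂ →
    (∀ r, ∃ q, ((r = a₀ ∨ r = b₀) ↔ (q = a₁ ∨ q = b₁)) ∧
      ((r = a₁ ∨ r = b₁) ↔ (q = a₂ ∨ q = b₂))) →
    DegenerateRel fun r q => ((r = a₀ ∨ r = b₀) ↔ (q = a₁ ∨ q = b₁)) ∧
      ((r = a₁ ∨ r = b₁) ↔ (q = a₂ ∨ q = b₂)) := by
  decide

theorem DegenerateRel.degenerate {m : ℕ} {τ : Equiv.Perm (Fin 4 × Fin m)}
    {E : Fin 4 → Fin 4 → Prop} (hE : DegenerateRel E) (h : ∀ x, E x.1 (τ x).1) :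
    Degenerate τ := by
  have key : ∀ {l : Fin 4 → Fin 4} {π : Equiv.Perm (Fin 4)}, LabelledBy E l π →
      Intertwines l π τ := fun hl x => hl _ _ (h x)
  exact hE.imp (fun ⟨s, hs⟩ => ⟨s, key hs⟩) (Or.imp key (Or.imp key (Or.imp key
    (Or.imp key (Or.imp key key)))))

/-- The blocks reached by `τ` from the blocks in `S`. -/
def blockImage {m : ℕ} (τ : Equiv.Perm (Fin 4 × Fin m)) (S : Finset (Fin 4)) : Finset (Fin 4) :=
  Finset.univ.filter fun q => ∃ x, x.1 ∈ S ∧ (τ x).1 = q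

theorem mem_blockImage {m : ℕ} {τ : Equiv.Perm (Fin 4 × Fin m)} {S : Finset (Fin 4)} {q : Fin 4} :
    q ∈ blockImage τ S ↔ ∃ x, x.1 ∈ S ∧ (τ x).1 = q := by
  simp [blockImage]

theorem map_product_subset {m : ℕ} (τ : Equiv.Perm (Fin 4 × Fin m)) (S : Finset (Fin 4)) :
    (S ×ˢ (Finset.univ : Finset (Fin m))).map τ.toEmbedding ⊆ blockImage τ S ×ˢ Finset.univ := by
  intro y hy
  obtain ⟨x, hx, rfl⟩ := Finset.mem_map.1 hy
  simp only [Finset.mem_product, Finset.mem_univ, and_true] at hx ⊢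
  exact mem_blockImage.2 ⟨x, hx, rfl⟩

theorem card_le_card_blockImage {m : ℕ} [NeZero m] (τ : Equiv.Perm (Fin 4 × Fin m))
    (S : Finset (Fin 4)) : S.card ≤ (blockImage τ S).card := by
  have h := Finset.card_le_card (map_product_subset τ S)
  simp only [Finset.card_map, Finset.card_product, Finset.card_fin] at h
  exact Nat.le_of_mul_le_mul_right h (Nat.pos_of_neZero m)

theorem mem_iff_of_card_blockImage_eq {m : ℕ} {τ : Equiv.Perm (Fin 4 × Fin m)}
    {S : Finset (Fin 4)} (h : (blockImage τ S).card = S.card) (x : Fin 4 × Fin m) :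
    x.1 ∈ S ↔ (τ x).1 ∈ blockImage τ S := by
  refine ⟨fun hx => mem_blockImage.2 ⟨x, hx, rfl⟩, fun hx => ?_⟩
  have heq := Finset.eq_of_subset_of_card_le (map_product_subset τ S) (by simp [h])
  have hmem : τ x ∈ blockImage τ S ×ˢ (Finset.univ : Finset (Fin m)) := by simpa using hx
  rw [← heq] at hmem
  simpa using hmem

theorem degenerate_of_card_one {m : ℕ} [NeZero m] {τ : Equiv.Perm (Fin 4 × Fin m)}
    (T : ℕ → Finset (Fin 4)) (hc : ∀ i, (T i).card = 1)
    (hT : ∀ i x, x.1 ∈ T i ↔ (τ x).1 ∈ T (i + 1)) : Degenerate τ := by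
  choose s hs using fun i => Finset.card_eq_one.1 (hc i)
  simp only [hs, Finset.mem_singleton] at hT
  exact (degenerateRel_of_points (s 0) (s 1) (s 2) (s 3)
    fun r => ⟨(τ (r, 0)).1, hT 0 (r, 0), hT 1 (r, 0), hT 2 (r, 0)⟩).degenerate
    fun x => ⟨hT 0 x, hT 1 x, hT 2 x⟩

theorem degenerate_of_card_two {m : ℕ} [NeZero m] {τ : Equiv.Perm (Fin 4 × Fin m)}
    (T : ℕ → Finset (Fin 4)) (hc : ∀ i, (T i).card = 2)
    (hT : ∀ i x, x.1 ∈ T i ↔ (τ x).1 ∈ T (i + 1)) : Degenerate τ := by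
  have hpair : ∀ i, ∃ a b, a < b ∧ T i = {a, b} := by
    intro i
    obtain ⟨a, b, hab, h⟩ := Finset.card_eq_two.1 (hc i)
    rcases lt_or_gt_of_ne hab with h' | h'
    · exact ⟨a, b, h', h⟩
    · exact ⟨b, a, h', by rw [h, Finset.pair_comm]⟩
  choose a b hab hs using hpair
  simp only [hs, Finset.mem_insert, Finset.mem_singleton] at hT
  exact (degenerateRel_of_pairs _ _ (hab 0) _ _ (hab 1) _ _ (hab 2)
    fun r => ⟨(τ (r, 0)).1, hT 0 (r, 0), hT 1 (r, 0)⟩).degenerate fun x => ⟨hT 0 x, hT 1 x⟩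

theorem exists_iterate_blockImage_eq_univ {m : ℕ} [NeZero m] {τ : Equiv.Perm (Fin 4 × Fin m)}
    (hτ : ¬ Degenerate τ) (r : Fin 4) : ∃ n, (blockImage τ)^[n] {r} = Finset.univ := by
  by_contra! hne
  set c : ℕ → ℕ := fun n => ((blockImage τ)^[n] {r}).card with hcdef
  have hmono : Monotone c := monotone_nat_of_le_succ fun n => by
    simp only [hcdef, Function.iterate_succ_apply']
    exact card_le_card_blockImage _ _
  have hlt : ∀ n, c n < 4 := fun n => by
    by_contra! h
    exact hne n ((Finset.card_eq_iff_eq_univ _).1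
      (le_antisymm (Finset.card_le_univ _) (by simpa using h)))
  obtain ⟨n₀, hn₀⟩ : ∃ n₀, ∀ n, c n ≤ c n₀ := by
    have hfin : (range c).Finite := (Set.finite_Iio 4).subset (by rintro _ ⟨n, rfl⟩; exact hlt n)
    obtain ⟨_, ⟨n₀, rfl⟩, h⟩ := Set.exists_max_image (range c) id hfin ⟨_, 0, rfl⟩
    exact ⟨n₀, fun n => h _ ⟨n, rfl⟩⟩
  have hconst : ∀ i, c (n₀ + i) = c n₀ := fun i => le_antisymm (hn₀ _) (hmono (by omega))
  set T : ℕ → Finset (Fin 4) := fun i => (blockImage τ)^[n₀ + i] {r} with hTdef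
  have hTc : ∀ i, (T i).card = c n₀ := hconst
  have hT : ∀ i x, x.1 ∈ T i ↔ (τ x).1 ∈ T (i + 1) := by
    intro i x
    have hs : T (i + 1) = blockImage τ (T i) := by
      simp only [hTdef, ← add_assoc, Function.iterate_succ_apply']
    rw [hs]
    exact mem_iff_of_card_blockImage_eq (by rw [← hs, hTc, hTc]) x
  have hpos : 1 ≤ c n₀ := by
    have : c 0 = 1 := by simp [hcdef]
    exact this ▸ hmono (Nat.zero_le n₀)
  have := hlt n₀
  obtain h | h | h : c n₀ = 1 ∨ c n₀ = 2 ∨ c n₀ = 3 := by omega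
  · exact hτ (degenerate_of_card_one T (fun i => (hTc i).trans h) hT)
  · exact hτ (degenerate_of_card_two T (fun i => (hTc i).trans h) hT)
  · refine hτ (degenerate_of_card_one (fun i => (T i)ᶜ) (fun i => ?_) fun i x => ?_)
    · rw [Finset.card_compl, hTc, h]; rfl
    · simp only [Finset.mem_compl, hT i x]

theorem blockImage_univ {m : ℕ} [NeZero m] (τ : Equiv.Perm (Fin 4 × Fin m)) :
    blockImage τ Finset.univ = Finset.univ :=
  (Finset.card_eq_iff_eq_univ _).1
    (le_antisymm (Finset.card_le_univ _) (card_le_card_blockImage τ Finset.univ))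

theorem exists_forall_iterate_blockImage_eq_univ {m : ℕ} [NeZero m]
    {τ : Equiv.Perm (Fin 4 × Fin m)} (hτ : ¬ Degenerate τ) (r : Fin 4) :
    ∃ n₀, ∀ n ≥ n₀, (blockImage τ)^[n] {r} = Finset.univ := by
  obtain ⟨n₀, h⟩ := exists_iterate_blockImage_eq_univ hτ r
  refine ⟨n₀, fun n hn => ?_⟩
  induction n, hn using Nat.le_induction with
  | base => exact h
  | succ n _ ih => rw [Function.iterate_succ_apply', ih, blockImage_univ]

/-- The position of `b` in the division of `ℤ/4m` into four consecutive blocks of length `m`. -/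
def blockEquiv (m : ℕ) [NeZero m] : ZMod (4 * m) ≃ Fin 4 × Fin m :=
  (ZMod.finEquiv (4 * m)).symm.toEquiv.trans finProdFinEquiv.symm

/-- The residue and the quotient of `b` modulo `4`. -/
def residueEquiv (m : ℕ) [NeZero m] : ZMod (4 * m) ≃ Fin 4 × Fin m :=
  (ZMod.finEquiv (4 * m)).symm.toEquiv.trans ((finCongr (mul_comm 4 m)).trans
    (finProdFinEquiv.symm.trans (Equiv.prodComm _ _)))

theorem val_finEquiv_symm {n : ℕ} [NeZero n] (b : ZMod n) :
    (((ZMod.finEquiv n).symm b : Fin n) : ℕ) = b.val := by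
  cases n with
  | zero => exact absurd rfl (NeZero.ne 0)
  | succ n => rfl

theorem val_eq_blockEquiv (m : ℕ) [NeZero m] (b : ZMod (4 * m)) :
    b.val = (blockEquiv m b).2 + m * (blockEquiv m b).1 := by
  rw [← val_finEquiv_symm, ← finProdFinEquiv_apply_val]
  simp [blockEquiv, Nat.mod_add_div]

theorem val_eq_residueEquiv (m : ℕ) [NeZero m] (b : ZMod (4 * m)) :
    b.val = (residueEquiv m b).1 + 4 * (residueEquiv m b).2 := by
  have := finProdFinEquiv_apply_val ((residueEquiv m b).2, (residueEquiv m b).1)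
  simp only at this
  rw [← this, ← val_finEquiv_symm]
  simp [residueEquiv, Nat.mod_add_div]

/-- The index of the interval `I_j` that contains `x`. -/
noncomputable def idx (N : ℕ) (x : Set.Ico (0:ℝ) 1) : ZMod N := ((⌊(N : ℝ) * x.val⌋ : ℤ) : ZMod N)

theorem idx_eq_iff {N : ℕ} [NeZero N] (x : Set.Ico (0:ℝ) 1) (b : ZMod N) :
    idx N x = b ↔ (b.val : ℝ) ≤ N * x.val ∧ (N : ℝ) * x.val < b.val + 1 := by
  have hN : (0 : ℝ) < N := by exact_mod_cast Nat.pos_of_neZero N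
  have h0 : (0 : ℤ) ≤ ⌊(N : ℝ) * x.val⌋ := Int.floor_nonneg.2 (mul_nonneg hN.le x.2.1)
  have h1 : ⌊(N : ℝ) * x.val⌋ < N := Int.floor_lt.2 (by
    have := mul_lt_mul_of_pos_left x.2.2 hN
    simpa using this)
  have hval : ((idx N x).val : ℤ) = ⌊(N : ℝ) * x.val⌋ := by
    rw [idx, ZMod.val_intCast, Int.emod_eq_of_lt h0 h1]
  have : idx N x = b ↔ ⌊(N : ℝ) * x.val⌋ = (b.val : ℤ) := by
    rw [← hval, Nat.cast_inj]
    exact (ZMod.val_injective N).eq_iff.symm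
  rw [this, Int.floor_eq_iff]
  simp

theorem permMap_val {N : ℕ} [NeZero N] (σ : Equiv.Perm (ZMod N)) (x : Set.Ico (0:ℝ) 1) :
    (permMap N σ x).val = x.val + (((σ (idx N x)).val : ℝ) - (idx N x).val) / N := by
  have hN : (0 : ℝ) < N := by exact_mod_cast Nat.pos_of_neZero N
  obtain ⟨h1, h2⟩ := (idx_eq_iff x (idx N x)).1 rfl
  have h3 : ((σ (idx N x)).val : ℝ) + 1 ≤ N := by exact_mod_cast ZMod.val_lt (σ (idx N x))
  have h4 : (0 : ℝ) ≤ ((σ (idx N x)).val : ℝ) := Nat.cast_nonneg _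
  have e : x.val = (N * x.val) / N := by field_simp
  change Int.fract (x.val + (((σ (idx N x)).val : ℝ) - (idx N x).val) / N) = _
  rw [Int.fract_eq_self, e, ← add_div]
  constructor
  · apply div_nonneg _ hN.le
    linarith
  · rw [div_lt_one hN]
    linarith

theorem idx_permMap {N : ℕ} [NeZero N] (σ : Equiv.Perm (ZMod N)) (x : Set.Ico (0:ℝ) 1) :
    idx N (permMap N σ x) = σ (idx N x) := by
  have hN : (0 : ℝ) < N := by exact_mod_cast Nat.pos_of_neZero N
  obtain ⟨h1, h2⟩ := (idx_eq_iff x (idx N x)).1 rfl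
  rw [idx_eq_iff, permMap_val, mul_add, mul_div_cancel₀ _ hN.ne']
  constructor <;> linarith

theorem permMap_permMap_symm {N : ℕ} [NeZero N] (σ : Equiv.Perm (ZMod N)) (x : Set.Ico (0:ℝ) 1) :
    permMap N σ (permMap N σ.symm x) = x := by
  apply Subtype.ext
  rw [permMap_val, idx_permMap, permMap_val]
  simp only [Equiv.apply_symm_apply]
  ring

theorem permMap_symm_permMap {N : ℕ} [NeZero N] (σ : Equiv.Perm (ZMod N)) (x : Set.Ico (0:ℝ) 1) :
    permMap N σ.symm (permMap N σ x) = x := by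
  simpa using permMap_permMap_symm σ.symm x

theorem residueEquiv_idx {m : ℕ} [NeZero m] (x : Set.Ico (0:ℝ) 1) :
    (residueEquiv m (idx (4 * m) x)).1 = (blockEquiv m (idx (4 * m) (mulMap m x))).1 ∧
    ((residueEquiv m (idx (4 * m) x)).2 : ℝ) + (mulMap m x).val = m * x.val := by
  have hm : (0 : ℝ) < m := by exact_mod_cast Nat.pos_of_neZero m
  obtain ⟨h1, h2⟩ := (idx_eq_iff (N := 4 * m) x _).1 rfl
  obtain ⟨h3, h4⟩ := (idx_eq_iff (N := 4 * m) (mulMap m x) _).1 rfl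
  rw [val_eq_residueEquiv] at h1 h2
  rw [val_eq_blockEquiv] at h3 h4
  set r := (residueEquiv m (idx (4 * m) x)).1
  set i := (residueEquiv m (idx (4 * m) x)).2
  set s := (blockEquiv m (idx (4 * m) (mulMap m x))).1
  set j := (blockEquiv m (idx (4 * m) (mulMap m x))).2
  have hw : (mulMap m x).val = m * x.val - ⌊m * x.val⌋ := rfl
  set w := (mulMap m x).val
  set k := ⌊(m : ℝ) * x.val⌋
  have hj : ((j : ℕ) : ℝ) + 1 ≤ m := by exact_mod_cast j.2
  have hj0 : (0 : ℝ) ≤ (j : ℕ) := Nat.cast_nonneg _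
  push_cast at h1 h2 h3 h4
  have h5 : (s : ℝ) ≤ 4 * w := by
    refine le_of_mul_le_mul_left ?_ hm
    linarith
  have h6 : 4 * w < (s : ℝ) + 1 := by
    refine lt_of_mul_lt_mul_left ?_ hm.le
    linarith
  have h7 : ((r : ℕ) : ℝ) + 4 * (i : ℕ) < s + 4 * k + 1 := by linarith
  have h8 : (s : ℝ) + 4 * k < (r : ℕ) + 4 * (i : ℕ) + 1 := by linarith
  have h7' : ((r : ℕ) : ℤ) + 4 * (i : ℕ) < (s : ℕ) + 4 * k + 1 := by exact_mod_cast h7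
  have h8' : ((s : ℕ) : ℤ) + 4 * k < (r : ℕ) + 4 * (i : ℕ) + 1 := by exact_mod_cast h8
  have hr := r.2
  have hs := s.2
  refine ⟨Fin.ext (by omega), ?_⟩
  have : ((i : ℕ) : ℤ) = k := by omega
  have : ((i : ℕ) : ℝ) = k := by exact_mod_cast this
  rw [hw, this]
  ring

/-- The `i`-th inverse branch of `mulMap m`. -/
noncomputable def branch {m : ℕ} (i : Fin m) (w : Set.Ico (0:ℝ) 1) : Set.Ico (0:ℝ) 1 :=
  ⟨((i : ℕ) + w.val) / m, by
    have hm : (0 : ℝ) < m := by exact_mod_cast i.pos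
    have hi : ((i : ℕ) : ℝ) + 1 ≤ m := by exact_mod_cast i.2
    have h0 := w.2.1
    have h1 := w.2.2
    exact ⟨by positivity, by rw [div_lt_one hm]; linarith⟩⟩

theorem mul_branch {m : ℕ} (i : Fin m) (w : Set.Ico (0:ℝ) 1) :
    (m : ℝ) * (branch i w).val = (i : ℕ) + w.val := by
  have hm : (0 : ℝ) < m := by exact_mod_cast i.pos
  exact mul_div_cancel₀ _ hm.ne'

theorem mulMap_branch {m : ℕ} (i : Fin m) (w : Set.Ico (0:ℝ) 1) : mulMap m (branch i w) = w := by
  apply Subtype.ext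
  change Int.fract ((m : ℝ) * (branch i w).val) = _
  rw [mul_branch, Int.fract_natCast_add, Int.fract_eq_self]
  exact w.2

theorem residueEquiv_idx_branch {m : ℕ} [NeZero m] (i : Fin m) (w : Set.Ico (0:ℝ) 1) :
    residueEquiv m (idx (4 * m) (branch i w)) = ((blockEquiv m (idx (4 * m) w)).1, i) := by
  obtain ⟨h1, h2⟩ := residueEquiv_idx (m := m) (branch i w)
  rw [mulMap_branch] at h1 h2
  rw [mul_branch] at h2
  refine Prod.ext h1 (Fin.ext ?_)
  exact_mod_cast add_right_cancel h2

/-- The composition of `x ↦ m x mod 1` with the interval exchange of `σ`. -/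
noncomputable def shuffled (m : ℕ) (σ : Equiv.Perm (ZMod (4 * m))) (x : Set.Ico (0:ℝ) 1) :
    Set.Ico (0:ℝ) 1 :=
  permMap (4 * m) σ (mulMap m x)

/-- `σ` read from blocks to residue classes modulo `4`. -/
def blockPerm (m : ℕ) [NeZero m] : Equiv.Perm (ZMod (4 * m)) ≃ Equiv.Perm (Fin 4 × Fin m) :=
  (blockEquiv m).equivCongr (residueEquiv m)

theorem blockPerm_apply {m : ℕ} [NeZero m] (σ : Equiv.Perm (ZMod (4 * m))) (b : ZMod (4 * m)) :
    blockPerm m σ (blockEquiv m b) = residueEquiv m (σ b) := by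
  simp [blockPerm]

section Dynamics

variable {m : ℕ} [NeZero m] (σ : Equiv.Perm (ZMod (4 * m)))

theorem exists_shuffled_eq (y : Set.Ico (0:ℝ) 1) (a : ZMod (4 * m))
    (h : (residueEquiv m a).1 = (blockEquiv m (σ.symm (idx (4 * m) y))).1) :
    ∃ x, idx (4 * m) x = a ∧ shuffled m σ x = y ∧
      m * x.val = (residueEquiv m a).2 + (permMap (4 * m) σ.symm y).val := by
  refine ⟨branch (residueEquiv m a).2 (permMap (4 * m) σ.symm y), ?_, ?_, mul_branch _ _⟩
  · apply (residueEquiv m).injective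
    rw [residueEquiv_idx_branch, idx_permMap, ← h]
  · rw [shuffled, mulMap_branch, permMap_permMap_symm]

theorem exists_shuffled_eq_near (u y : Set.Ico (0:ℝ) 1)
    (h : idx (4 * m) y = idx (4 * m) (shuffled m σ u)) :
    ∃ x, idx (4 * m) x = idx (4 * m) u ∧ shuffled m σ x = y ∧
      m * (x.val - u.val) = y.val - (shuffled m σ u).val := by
  obtain ⟨h1, h2⟩ := residueEquiv_idx (m := m) u
  obtain ⟨x, hx, hxy, hd⟩ := exists_shuffled_eq σ y (idx (4 * m) u) (by
    rw [h, shuffled, idx_permMap, Equiv.symm_apply_apply, h1])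
  refine ⟨x, hx, hxy, ?_⟩
  have h3 : (permMap (4 * m) σ.symm (shuffled m σ u)).val = (mulMap m u).val := by
    rw [shuffled, permMap_symm_permMap]
  rw [permMap_val] at hd h3
  rw [← h] at h3
  linarith

theorem exists_iterate_shuffled_eq_near (n : ℕ) : ∀ u y : Set.Ico (0:ℝ) 1,
    idx (4 * m) y = idx (4 * m) ((shuffled m σ)^[n] u) →
    ∃ x, idx (4 * m) x = idx (4 * m) u ∧ (shuffled m σ)^[n] x = y ∧
      (m : ℝ) ^ n * (x.val - u.val) = y.val - ((shuffled m σ)^[n] u).val := by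
  induction n with
  | zero => exact fun u y h => ⟨y, h, rfl, by simp⟩
  | succ n ih =>
    intro u y h
    obtain ⟨z, hz, hzy, hd⟩ := ih (shuffled m σ u) y h
    obtain ⟨x, hx, hxz, hd'⟩ := exists_shuffled_eq_near σ u z hz
    refine ⟨x, hx, by rw [Function.iterate_succ_apply, hxz, hzy], ?_⟩
    rw [Function.iterate_succ_apply, ← hd, pow_succ, mul_assoc, hd']

theorem exists_covered_of_mem_iterate_blockImage (a : ZMod (4 * m)) (n : ℕ) : ∀ s : Fin 4,
    s ∈ (blockImage (blockPerm m σ))^[n] {(residueEquiv m a).1} →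
    ∃ a', (residueEquiv m a').1 = s ∧
      ∀ y, idx (4 * m) y = a' → ∃ x, idx (4 * m) x = a ∧ (shuffled m σ)^[n] x = y := by
  induction n with
  | zero =>
    intro s hs
    exact ⟨a, (Finset.mem_singleton.1 hs).symm, fun y hy => ⟨y, hy, rfl⟩⟩
  | succ n ih =>
    intro s hs
    rw [Function.iterate_succ_apply'] at hs
    obtain ⟨z, hz, hzs⟩ := mem_blockImage.1 hs
    obtain ⟨a', ha', hcov⟩ := ih _ hz
    obtain ⟨b, rfl⟩ := (blockEquiv m).surjective z
    rw [blockPerm_apply] at hzs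
    refine ⟨σ b, hzs, fun y hy => ?_⟩
    obtain ⟨w, hw, hwy, -⟩ := exists_shuffled_eq σ y a' (by rw [hy, Equiv.symm_apply_apply, ha'])
    obtain ⟨x, hx, hxw⟩ := hcov w hw
    exact ⟨x, hx, by rw [Function.iterate_succ_apply', hxw, hwy]⟩

theorem exists_iterate_succ_shuffled_eq (a : ZMod (4 * m)) {n : ℕ}
    (h : (blockImage (blockPerm m σ))^[n] {(residueEquiv m a).1} = Finset.univ)
    (y : Set.Ico (0:ℝ) 1) : ∃ x, idx (4 * m) x = a ∧ (shuffled m σ)^[n + 1] x = y := by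
  obtain ⟨a', ha', hcov⟩ := exists_covered_of_mem_iterate_blockImage σ a n
    (blockEquiv m (σ.symm (idx (4 * m) y))).1 (by rw [h]; exact Finset.mem_univ _)
  obtain ⟨w, hw, hwy, -⟩ := exists_shuffled_eq σ y a' ha'
  obtain ⟨x, hx, hxw⟩ := hcov w hw
  exact ⟨x, hx, by rw [Function.iterate_succ_apply', hxw, hwy]⟩

theorem topMixing_shuffled (hm : 2 ≤ m) (hσ : ¬ Degenerate (blockPerm m σ)) :
    TopMixing (shuffled m σ) := by
  rintro U V hU - ⟨u, hu⟩ ⟨v, hv⟩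
  obtain ⟨ε, hε, hball⟩ := Metric.isOpen_iff.1 hU u hu
  have hm1 : (1 : ℝ) < m := by exact_mod_cast hm
  obtain ⟨k, hk⟩ := pow_unbounded_of_one_lt (1 / ε) hm1
  obtain ⟨q, hq⟩ := exists_forall_iterate_blockImage_eq_univ hσ
    (residueEquiv m (idx (4 * m) ((shuffled m σ)^[k] u))).1
  refine ⟨k + (q + 1), fun n hn => ?_⟩
  obtain ⟨l, rfl⟩ := Nat.exists_eq_add_of_le hn
  obtain ⟨y, hy, hyv⟩ := exists_iterate_succ_shuffled_eq σ _ (hq (q + l) (by omega)) v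
  obtain ⟨x, -, hxy, hd⟩ := exists_iterate_shuffled_eq_near σ k u y hy
  refine ⟨v, ⟨x, hball ?_, ?_⟩, hv⟩
  · have hpow : (0 : ℝ) < (m : ℝ) ^ k := by positivity
    have h1 : |(m : ℝ) ^ k * (x.val - u.val)| < 1 := by
      rw [hd, abs_lt]
      have h2 := y.2
      have h3 := ((shuffled m σ)^[k] u).2
      constructor <;> linarith [h2.1, h2.2, h3.1, h3.2]
    rw [abs_mul, abs_of_pos hpow] at h1
    rw [Metric.mem_ball, Subtype.dist_eq, Real.dist_eq]
    rw [div_lt_iff₀ hε] at hk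
    exact lt_of_mul_lt_mul_left (h1.trans hk) hpow.le
  · rw [show k + (q + 1) + l = (q + l + 1) + k by ring, Function.iterate_add_apply, hxy, hyv]

theorem not_topMixing_of_intertwines {h : Fin 4 → Fin 4} {π : Equiv.Perm (Fin 4)}
    (hσ : Intertwines h π (blockPerm m σ)) (hπ : ∀ r q, h q = h (π r) → h (π q) = h r)
    {r₁ r₂ : Fin 4} (hne : h r₁ ≠ h r₂) : ¬ TopMixing (shuffled m σ) := by
  set c : Set.Ico (0:ℝ) 1 → Fin 4 := fun x => (residueEquiv m (idx (4 * m) x)).1 with hc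
  have hstep : ∀ x, h (c (shuffled m σ x)) = h (π (c x)) := by
    intro x
    simp only [hc, shuffled, idx_permMap, (residueEquiv_idx x).1, ← blockPerm_apply]
    exact hσ _
  have heven : ∀ n x, h (c ((shuffled m σ)^[2 * n] x)) = h (c x) := by
    intro n
    induction n with
    | zero => exact fun x => rfl
    | succ n ih =>
      intro x
      rw [show 2 * (n + 1) = 2 * n + 1 + 1 by ring, Function.iterate_succ_apply,
        Function.iterate_succ_apply, ih, hstep]
      exact hπ _ _ (hstep x)
  set W : Fin 4 → Set (Set.Ico (0:ℝ) 1) := fun r =>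
    {x | (((residueEquiv m).symm (r, 0)).val : ℝ) < (4 * m : ℕ) * x.val ∧
      ((4 * m : ℕ) : ℝ) * x.val < ((residueEquiv m).symm (r, 0)).val + 1} with hW
  have hWopen : ∀ r, IsOpen (W r) := fun r =>
    (isOpen_Ioo.preimage (f := fun x : Set.Ico (0:ℝ) 1 => ((4 * m : ℕ) : ℝ) * x.val) (by fun_prop) :)
  have hWc : ∀ r, ∀ x ∈ W r, c x = r := by
    intro r x hx
    rw [hc]
    simp only
    rw [(idx_eq_iff x _).2 ⟨hx.1.le, hx.2⟩, Equiv.apply_symm_apply]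
  have hWne : ∀ r, (W r).Nonempty := by
    intro r
    have hN : (0 : ℝ) < (4 * m : ℕ) := by exact_mod_cast Nat.pos_of_neZero (4 * m)
    set b := (residueEquiv m).symm (r, 0)
    have h3 : (b.val : ℝ) + 1 ≤ (4 * m : ℕ) := by exact_mod_cast ZMod.val_lt b
    have h4 : (0 : ℝ) ≤ (b.val : ℝ) := Nat.cast_nonneg _
    refine ⟨⟨((b.val : ℝ) + 1 / 2) / (4 * m : ℕ), by positivity, ?_⟩, ?_, ?_⟩
    · rw [div_lt_one hN]; linarith
    · simp only [mul_div_cancel₀ _ hN.ne']; linarith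
    · simp only [mul_div_cancel₀ _ hN.ne']; linarith
  intro hmix
  obtain ⟨n, hn⟩ := hmix (W r₁) (W r₂) (hWopen _) (hWopen _) (hWne _) (hWne _)
  obtain ⟨_, ⟨x, hx, rfl⟩, hy⟩ := hn (2 * n) (by omega)
  have := heven n x
  rw [hWc _ _ hx, hWc _ _ hy] at this
  exact hne this.symm

theorem not_topMixing_shuffled_iff (hm : 2 ≤ m) :
    ¬ TopMixing (shuffled m σ) ↔ Degenerate (blockPerm m σ) := by
  refine ⟨fun h => by_contra fun hσ => h (topMixing_shuffled σ hm hσ), ?_⟩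
  rintro (⟨s, h⟩ | h | h | h | h | h | h)
  · obtain ⟨t, ht⟩ : ∃ t, pointLabel s s ≠ pointLabel s t := by
      clear h; revert s; decide
    exact not_topMixing_of_intertwines σ h (fun _ _ hq => hq) ht
  · exact not_topMixing_of_intertwines σ h (by decide) (r₁ := 0) (r₂ := 2) (by decide)
  · exact not_topMixing_of_intertwines σ h (by decide) (r₁ := 0) (r₂ := 1) (by decide)
  · exact not_topMixing_of_intertwines σ h (by decide) (r₁ := 0) (r₂ := 1) (by decide)
  · exact not_topMixing_of_intertwines σ h (by decide) (r₁ := 0) (r₂ := 2) (by decide)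
  · exact not_topMixing_of_intertwines σ h (by decide) (r₁ := 0) (r₂ := 1) (by decide)
  · exact not_topMixing_of_intertwines σ h (by decide) (r₁ := 0) (r₂ := 1) (by decide)

end Dynamics

theorem ncard_not_topMixing {m : ℕ} [NeZero m] (hm : 2 ≤ m) :
    {σ : Equiv.Perm (ZMod (4 * m)) | ¬ TopMixing (shuffled m σ)}.ncard
      = ((Finset.univ : Finset (Equiv.Perm (Fin 4 × Fin m))).filter Degenerate).card := by
  have : {σ : Equiv.Perm (ZMod (4 * m)) | ¬ TopMixing (shuffled m σ)}
      = blockPerm m ⁻¹' ((Finset.univ : Finset (Equiv.Perm (Fin 4 × Fin m))).filter Degenerate :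
        Finset _) := by
    ext σ
    simp [not_topMixing_shuffled_iff σ hm]
  rw [this, Set.ncard_preimage_of_injective_subset_range (blockPerm m).injective
    (by simp [(blockPerm m).surjective.range_eq]), Set.ncard_coe_finset]

end QuarterMixing

/-- for `N = 4m`, the proportion of non-mixing permutations equals
`[ 4·(3m)!/(m!·m!·m!) + 6·C(2m,m)² − 12·C(2m,m) ] · (m!)⁴ / (4m)!`. -/
theorem stmt10 (m : ℕ) (hm : 2 ≤ m) :
    ({σ : Equiv.Perm (ZMod (4 * m)) |
        ¬ TopMixing (fun x => permMap (4 * m) σ (mulMap m x))}.ncard : ℝ)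
        / ((4 * m).factorial : ℝ)
      = (4 * (((3 * m).factorial : ℝ)
              / ((m.factorial : ℝ) * (m.factorial : ℝ) * (m.factorial : ℝ)))
         + 6 * (((2 * m).choose m : ℝ)) ^ 2
         - 12 * (((2 * m).choose m : ℝ)))
        * ((m.factorial : ℝ)) ^ 4 / (((4 * m).factorial : ℝ)) := by
  have : NeZero m := ⟨by omega⟩
  have hcount : ({σ : Equiv.Perm (ZMod (4 * m)) |
        ¬ TopMixing (fun x => permMap (4 * m) σ (mulMap m x))}.ncard : ℝ)
      + 12 * (((2 * m).factorial : ℝ) * (m.factorial : ℝ) ^ 2)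
      = 4 * ((m.factorial : ℝ) * ((3 * m).factorial : ℝ)) + 6 * ((2 * m).factorial : ℝ) ^ 2 := by
    have h := QuarterMixing.card_degenerate m
    rw [← QuarterMixing.ncard_not_topMixing hm] at h
    exact_mod_cast h
  have hchoose : ((2 * m).choose m : ℝ) * (m.factorial : ℝ) ^ 2 = ((2 * m).factorial : ℝ) := by
    have h := Nat.choose_mul_factorial_mul_factorial (show m ≤ 2 * m by omega)
    rw [show 2 * m - m = m by omega, mul_assoc, ← pow_two] at h
    exact_mod_cast h
  have hm0 : (m.factorial : ℝ) ≠ 0 := by exact_mod_cast m.factorial_ne_zero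
  congr 1
  rw [eq_sub_of_add_eq hcount, ← hchoose]
  field_simp
end

section
/- Let m ≥ 2 be an integer and let 2 ≤ j ≤ ℓ be integers. Then b_j(ℓ) ≤ Σ_{r=1}^{⌊ℓ/j⌋} C(ℓ,r) · C(mℓ, mr)^{−1} · b_{j−1}(ℓ − r), where C(a,b) denotes the binomial coefficient. -/
/-- `b_j(ℓ) = Σ (ℓ choose r₁,…,r_j) / (mℓ choose mr₁,…,mr_j)`, the sum being over
tuples `1 ≤ r₁ ≤ … ≤ r_j` with `r₁ + … + r_j = ℓ`. -/
noncomputable def bcoef (m j ℓ : ℕ) : ℝ :=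
  ∑ᶠ r ∈ {r : Fin j → ℕ | Monotone r ∧ (∀ i, 1 ≤ r i) ∧ (∑ i, r i) = ℓ},
    (Nat.multinomial Finset.univ r : ℝ)
      / (Nat.multinomial Finset.univ (fun i => m * r i) : ℝ)

theorem multinomial_univ_succ {k : ℕ} (f : Fin (k + 1) → ℕ) :
    Nat.multinomial Finset.univ f =
      (∑ i, f i).choose (f 0) * Nat.multinomial Finset.univ (Fin.tail f) := by
  rw [Fin.univ_succ, Nat.multinomial_cons, Finset.sum_cons, Nat.multinomial,
    Nat.multinomial, Finset.sum_map, Finset.prod_map]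
  rfl

/-- The tuples `1 ≤ r₁ ≤ … ≤ r_j` with `r₁ + … + r_j = ℓ`. -/
def orderedParts (j ℓ : ℕ) : Set (Fin j → ℕ) :=
  {r | Monotone r ∧ (∀ i, 1 ≤ r i) ∧ (∑ i, r i) = ℓ}

theorem orderedParts_finite (j ℓ : ℕ) : (orderedParts j ℓ).Finite := by
  refine (Set.Finite.pi' fun _ : Fin j => Set.finite_Iic ℓ).subset ?_
  rintro r ⟨-, -, hr⟩ i
  exact hr ▸ Finset.single_le_sum (fun i _ => Nat.zero_le (r i)) (Finset.mem_univ i)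

/-- The summand of `bcoef`. -/
noncomputable def multinomialRatio (m : ℕ) {j : ℕ} (r : Fin j → ℕ) : ℝ :=
  (Nat.multinomial Finset.univ r : ℝ) / (Nat.multinomial Finset.univ (fun i => m * r i) : ℝ)

theorem multinomialRatio_nonneg (m : ℕ) {j : ℕ} (r : Fin j → ℕ) : 0 ≤ multinomialRatio m r := by
  unfold multinomialRatio
  positivity

theorem multinomialRatio_succ (m : ℕ) {k : ℕ} (r : Fin (k + 1) → ℕ) :
    multinomialRatio m r = ((∑ i, r i).choose (r 0) : ℝ) *
      ((m * ∑ i, r i).choose (m * r 0) : ℝ)⁻¹ * multinomialRatio m (Fin.tail r) := by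
  have h : Fin.tail (fun i => m * r i) = fun i => m * Fin.tail r i := rfl
  rw [multinomialRatio, multinomialRatio, multinomial_univ_succ r,
    multinomial_univ_succ (fun i => m * r i), ← Finset.mul_sum, h]
  push_cast
  rw [mul_div_mul_comm, div_eq_mul_inv]

theorem bcoef_eq_sum (m j ℓ : ℕ) :
    bcoef m j ℓ = ∑ r ∈ (orderedParts_finite j ℓ).toFinset, multinomialRatio m r :=
  finsum_mem_eq_finite_toFinset_sum _ _

theorem tail_mem_orderedParts {k ℓ : ℕ} {r : Fin (k + 1) → ℕ} (hr : r ∈ orderedParts (k + 1) ℓ) :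
    Fin.tail r ∈ orderedParts k (ℓ - r 0) := by
  obtain ⟨hmono, hpos, hsum⟩ := hr
  refine ⟨hmono.comp (Fin.strictMono_succ).monotone, fun i => hpos _, ?_⟩
  rw [Fin.sum_univ_succ] at hsum
  exact Nat.eq_sub_of_add_eq' hsum

theorem head_mem_Icc {k ℓ : ℕ} {r : Fin (k + 1) → ℕ} (hr : r ∈ orderedParts (k + 1) ℓ) :
    r 0 ∈ Finset.Icc 1 (ℓ / (k + 1)) := by
  obtain ⟨hmono, hpos, hsum⟩ := hr
  refine Finset.mem_Icc.2 ⟨hpos 0, (Nat.le_div_iff_mul_le k.succ_pos).2 ?_⟩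
  have h := Finset.card_nsmul_le_sum Finset.univ r (r 0) fun i _ => hmono (Fin.zero_le i)
  rw [hsum, Finset.card_univ, Fintype.card_fin, smul_eq_mul] at h
  rwa [mul_comm]

theorem bcoef_succ_le (m k ℓ : ℕ) :
    bcoef m (k + 1) ℓ ≤
      ∑ r ∈ Finset.Icc 1 (ℓ / (k + 1)),
        (ℓ.choose r : ℝ) * ((m * ℓ).choose (m * r) : ℝ)⁻¹ * bcoef m k (ℓ - r) := by
  rw [bcoef_eq_sum, ← Finset.sum_fiberwise_of_maps_to (g := fun r => r 0)
    fun r hr => head_mem_Icc ((Set.Finite.mem_toFinset _).1 hr)]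
  refine Finset.sum_le_sum fun a _ => ?_
  rw [bcoef_eq_sum]
  set F := {r ∈ (orderedParts_finite (k + 1) ℓ).toFinset | r 0 = a} with hF
  have mem_F {r : Fin (k + 1) → ℕ} (hr : r ∈ F) : r ∈ orderedParts (k + 1) ℓ ∧ r 0 = a := by
    simpa [hF] using hr
  have hinj : Set.InjOn (Fin.tail : (Fin (k + 1) → ℕ) → Fin k → ℕ) F := by
    intro r hr s hs hrs
    rw [← Fin.cons_self_tail r, ← Fin.cons_self_tail s, (mem_F hr).2, (mem_F hs).2, hrs]
  have hterm : ∀ r ∈ F, multinomialRatio m r = (ℓ.choose a : ℝ) *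
      ((m * ℓ).choose (m * a) : ℝ)⁻¹ * multinomialRatio m (Fin.tail r) := by
    intro r hr
    obtain ⟨⟨-, -, hsum⟩, ha⟩ := mem_F hr
    rw [multinomialRatio_succ, hsum, ha]
  rw [Finset.sum_congr rfl hterm, ← Finset.mul_sum, ← Finset.sum_image hinj]
  refine mul_le_mul_of_nonneg_left ?_ (by positivity)
  refine Finset.sum_le_sum_of_subset_of_nonneg ?_ fun r _ _ => multinomialRatio_nonneg m r
  intro t ht
  obtain ⟨r, hr, rfl⟩ := Finset.mem_image.1 ht
  obtain ⟨hmem, rfl⟩ := mem_F hr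
  exact (Set.Finite.mem_toFinset _).2 (tail_mem_orderedParts hmem)

/-- recursion bound
`b_j(ℓ) ≤ Σ_{r=1}^{⌊ℓ/j⌋} C(ℓ,r) C(mℓ,mr)⁻¹ b_{j−1}(ℓ−r)`. -/
theorem stmt12 (m j ℓ : ℕ) (hm : 2 ≤ m) (hj : 2 ≤ j) (hjl : j ≤ ℓ) :
    bcoef m j ℓ ≤
      ∑ r ∈ Finset.Icc 1 (ℓ / j),
        (ℓ.choose r : ℝ) * ((m * ℓ).choose (m * r) : ℝ)⁻¹ * bcoef m (j - 1) (ℓ - r) := by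
  obtain ⟨k, rfl⟩ := Nat.exists_eq_add_of_le' (one_le_two.trans hj)
  exact bcoef_succ_le m k ℓ
end

section
/- Let m ≥ 2 and ℓ ≥ 3 be integers. Then for all 1 ≤ j ≤ ℓ, b_j(ℓ) ≤ (2e/ℓ)^{(m−1)(j−1)}, where e is Euler's number. -/
open Finset Nat in
/-- Factorial products decrease towards the balanced split. -/
theorem factorial_mul_factorial_sub_le {L a : ℕ} (ha : 2 ≤ a) (h : 2 * a ≤ L) :
    a ! * (L - a)! ≤ 2 * (L - 2)! := by
  induction a, ha using Nat.le_induction with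
  | base => simp
  | succ a ha ih =>
    refine le_trans ?_ (ih (by omega))
    obtain ⟨d, rfl⟩ : ∃ d, L = a + 1 + d := ⟨L - (a + 1), by omega⟩
    have e1 : a + 1 + d - (a + 1) = d := by omega
    have e2 : a + 1 + d - a = d + 1 := by omega
    rw [e1, e2, Nat.factorial_succ, Nat.factorial_succ]
    have : a + 1 ≤ d + 1 := by omega
    calc (a + 1) * a ! * d ! = (a + 1) * (a ! * d !) := by ring
      _ ≤ (d + 1) * (a ! * d !) := Nat.mul_le_mul_right _ this
      _ = a ! * ((d + 1) * d !) := by ring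

open Finset Nat in
theorem sum_factorial_mul_factorial_sub_le (L : ℕ) :
    ∑ a ∈ Icc 1 (L / 2), a ! * (L - a)! ≤ 2 * (L - 1)! := by
  rcases Nat.lt_or_ge L 2 with hL | hL
  · have : L / 2 = 0 := by omega
    simp [this]
  have h1 : 1 ≤ L / 2 := by omega
  rw [← Finset.insert_Icc_add_one_left_eq_Icc h1, sum_insert (by simp)]
  have h2 : ∑ a ∈ Icc (1 + 1) (L / 2), a ! * (L - a)! ≤ (L / 2 - 1) * (2 * (L - 2)!) := by
    refine (sum_le_card_nsmul _ _ (2 * (L - 2)!) fun a ha => ?_).trans (by simp)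
    rw [mem_Icc] at ha
    exact factorial_mul_factorial_sub_le ha.1 (by omega)
  obtain ⟨d, rfl⟩ : ∃ d, L = d + 2 := ⟨L - 2, by omega⟩
  have e1 : d + 2 - 1 = d + 1 := by omega
  rw [e1, Nat.add_sub_cancel] at *
  have h3 : ((d + 2) / 2 - 1) * (2 * d !) ≤ (d + 1)! := by
    rw [Nat.factorial_succ, ← mul_assoc]
    exact Nat.mul_le_mul_right _ (by omega)
  rw [Nat.factorial_one, one_mul, two_mul]
  exact Nat.add_le_add_left (h2.trans h3) _

/-- The nondecreasing `j`-tuples of positive integers with sum `ℓ`. -/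
def sortedCompositions (j ℓ : ℕ) : Finset (Fin j → ℕ) :=
  {r ∈ Finset.univ.piAntidiag ℓ | Monotone r ∧ ∀ i, 1 ≤ r i}

theorem mem_sortedCompositions {j ℓ : ℕ} {r : Fin j → ℕ} :
    r ∈ sortedCompositions j ℓ ↔ Monotone r ∧ (∀ i, 1 ≤ r i) ∧ ∑ i, r i = ℓ := by
  simp [sortedCompositions]
  tauto

theorem cons_decomposition_of_mem_sortedCompositions {k ℓ : ℕ} {r : Fin (k + 2) → ℕ}
    (hr : r ∈ sortedCompositions (k + 2) ℓ) :
    r 0 ∈ Finset.Icc 1 ((ℓ - k) / 2) ∧ Fin.tail r ∈ sortedCompositions (k + 1) (ℓ - r 0) := by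
  obtain ⟨hmono, hpos, hsum⟩ := mem_sortedCompositions.1 hr
  rw [Fin.sum_univ_succ] at hsum
  refine ⟨?_, mem_sortedCompositions.2 ⟨?_, fun i => hpos _, ?_⟩⟩
  · rw [Fin.sum_univ_succ] at hsum
    have h1 : r 0 ≤ r (Fin.succ 0) := hmono (Fin.zero_le _)
    have h2 : k ≤ ∑ i : Fin k, r i.succ.succ := by
      simpa using Finset.card_nsmul_le_sum Finset.univ (fun i : Fin k => r i.succ.succ) 1
        fun i _ => hpos _
    have := hpos 0
    rw [Finset.mem_Icc]
    omega
  · exact fun i j hij => hmono (Fin.succ_le_succ_iff.2 hij)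
  · simp only [Fin.tail]
    omega

open Finset Nat in
theorem sum_prod_factorial_sortedCompositions_le (k ℓ : ℕ) :
    ∑ r ∈ sortedCompositions (k + 1) ℓ, ∏ i, (r i)! ≤ 2 ^ k * (ℓ - k)! := by
  induction k generalizing ℓ with
  | zero =>
    have h : sortedCompositions 1 ℓ ⊆ {fun _ => ℓ} := fun r hr => by
      have := (mem_sortedCompositions.1 hr).2.2
      rw [mem_singleton]
      funext i
      rw [Subsingleton.elim i 0]
      simpa using this
    exact (sum_le_sum_of_subset h).trans (by simp)
  | succ k ih =>
    let P := (Icc 1 ((ℓ - k) / 2)).sigma fun a => sortedCompositions (k + 1) (ℓ - a)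
    let c : (Σ _ : ℕ, Fin (k + 1) → ℕ) → Fin (k + 2) → ℕ :=
      fun p => Fin.cons (α := fun _ => ℕ) p.1 p.2
    have hc : Function.Injective c := by
      rintro ⟨a, r⟩ ⟨b, s⟩ h
      obtain ⟨rfl, rfl⟩ := Fin.cons_injective2 h
      rfl
    have hsub : sortedCompositions (k + 2) ℓ ⊆ P.image c := fun r hr =>
      mem_image.2 ⟨⟨r 0, Fin.tail r⟩,
        mem_sigma.2 (cons_decomposition_of_mem_sortedCompositions hr), Fin.cons_self_tail r⟩
    calc ∑ r ∈ sortedCompositions (k + 2) ℓ, ∏ i, (r i)!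
        ≤ ∑ r ∈ P.image c, ∏ i, (r i)! := sum_le_sum_of_subset hsub
      _ = ∑ a ∈ Icc 1 ((ℓ - k) / 2), a ! *
            ∑ r ∈ sortedCompositions (k + 1) (ℓ - a), ∏ i, (r i)! := by
          rw [sum_image hc.injOn, sum_sigma]
          simp only [c, Fin.prod_univ_succ (n := k + 1), Fin.cons_zero, Fin.cons_succ, mul_sum]
      _ ≤ ∑ a ∈ Icc 1 ((ℓ - k) / 2), a ! * (2 ^ k * (ℓ - k - a)!) := by
          gcongr with a
          rw [Nat.sub_right_comm]
          exact ih _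
      _ = 2 ^ k * ∑ a ∈ Icc 1 ((ℓ - k) / 2), a ! * (ℓ - k - a)! := by
          rw [mul_sum]
          exact sum_congr rfl fun _ _ => by ring
      _ ≤ 2 ^ k * (2 * (ℓ - k - 1)!) := by
          gcongr
          exact sum_factorial_mul_factorial_sub_le _
      _ = 2 ^ (k + 1) * (ℓ - (k + 1))! := by
          rw [pow_succ, mul_assoc, Nat.sub_sub]

theorem choose_mul_choose_le_choose_add (a b c d : ℕ) :
    a.choose b * c.choose d ≤ (a + c).choose (b + d) := by
  rw [Nat.add_choose_eq]
  exact Finset.single_le_sum (f := fun p : ℕ × ℕ => a.choose p.1 * c.choose p.2)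
    (fun _ _ => Nat.zero_le _) (a := (b, d)) (by simp)

theorem choose_pow_le_choose_mul (m a b : ℕ) :
    a.choose b ^ m ≤ (m * a).choose (m * b) := by
  induction m with
  | zero => simp
  | succ m ih =>
    rw [pow_succ, add_one_mul, add_one_mul]
    exact (Nat.mul_le_mul_right _ ih).trans (choose_mul_choose_le_choose_add _ _ _ _)

theorem multinomial_pow_le_multinomial_mul {ι : Type*} (m : ℕ) (s : Finset ι) (r : ι → ℕ) :
    Nat.multinomial s r ^ m ≤ Nat.multinomial s fun i => m * r i := by
  classical
  induction s using Finset.induction_on with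
  | empty => simp
  | insert a s ha ih =>
    rw [Nat.multinomial_insert ha, Nat.multinomial_insert ha, mul_pow, ← Finset.mul_sum,
      ← mul_add]
    exact Nat.mul_le_mul (choose_pow_le_choose_mul _ _ _) ih

open Nat in
theorem pow_mul_factorial_sub_le_exp_pow_mul_factorial {n k : ℕ} (h : k ≤ n) :
    (n : ℝ) ^ k * (n - k)! ≤ Real.exp 1 ^ k * n ! := by
  have h1 : n ^ k * k ! ≤ k ^ k * n.descFactorial k := by
    rw [← Nat.descFactorial_self, Nat.descFactorial_eq_prod_range,
      Nat.descFactorial_eq_prod_range]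
    have hpow (c : ℕ) : c ^ k = ∏ _i ∈ Finset.range k, c := by simp
    rw [hpow n, hpow k, ← Finset.prod_mul_distrib, ← Finset.prod_mul_distrib]
    refine Finset.prod_le_prod' fun i _ => ?_
    rw [Nat.mul_sub, Nat.mul_sub, mul_comm n k]
    exact Nat.sub_le_sub_left (Nat.mul_le_mul_right _ h) _
  have h2 : (k : ℝ) ^ k ≤ Real.exp 1 ^ k * k ! := by
    have := Real.pow_div_factorial_le_exp (k : ℝ) (Nat.cast_nonneg k) k
    rwa [div_le_iff₀ (by positivity), ← Real.exp_one_pow] at this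
  have h3 : (n : ℝ) ^ k ≤ Real.exp 1 ^ k * n.descFactorial k := by
    have hk : (0 : ℝ) < k ! := by positivity
    refine le_of_mul_le_mul_right ?_ hk
    calc (n : ℝ) ^ k * k ! ≤ k ^ k * n.descFactorial k := by exact_mod_cast h1
      _ ≤ Real.exp 1 ^ k * k ! * n.descFactorial k := by gcongr
      _ = _ := by ring
  rw [← Nat.factorial_mul_descFactorial h, Nat.cast_mul]
  calc (n : ℝ) ^ k * (n - k)! ≤ Real.exp 1 ^ k * n.descFactorial k * (n - k)! := by gcongr
    _ = _ := by ring

theorem sum_inv_multinomial_sortedCompositions_le {k ℓ : ℕ} (hk : k < ℓ) :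
    ∑ r ∈ sortedCompositions (k + 1) ℓ, (Nat.multinomial Finset.univ r : ℝ)⁻¹
      ≤ (2 * Real.exp 1 / ℓ) ^ k := by
  have hl : (0 : ℝ) < ℓ := by exact_mod_cast k.zero_le.trans_lt hk
  have hfac : (0 : ℝ) < ℓ.factorial := by positivity
  have hterm : ∀ r ∈ sortedCompositions (k + 1) ℓ,
      (Nat.multinomial Finset.univ r : ℝ)⁻¹ = (∏ i, (r i).factorial : ℕ) / ℓ.factorial := by
    intro r hr
    have h := Nat.multinomial_spec Finset.univ r
    rw [(mem_sortedCompositions.1 hr).2.2] at h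
    have hm : (Nat.multinomial Finset.univ r : ℝ) ≠ 0 := by
      exact_mod_cast (Nat.multinomial_pos _ _).ne'
    rw [eq_div_iff hfac.ne', ← h, Nat.cast_mul, mul_comm, mul_assoc, mul_inv_cancel₀ hm, mul_one]
  rw [Finset.sum_congr rfl hterm, ← Finset.sum_div, div_le_iff₀ hfac, div_pow, mul_pow,
    div_mul_eq_mul_div, le_div_iff₀ (by positivity), ← Nat.cast_sum]
  calc ((∑ r ∈ sortedCompositions (k + 1) ℓ, ∏ i, (r i).factorial : ℕ) : ℝ) * ℓ ^ k
      ≤ (2 ^ k * (ℓ - k).factorial : ℕ) * ℓ ^ k := by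
        gcongr
        exact sum_prod_factorial_sortedCompositions_le k ℓ
    _ = 2 ^ k * (ℓ ^ k * (ℓ - k).factorial) := by push_cast; ring
    _ ≤ 2 ^ k * (Real.exp 1 ^ k * ℓ.factorial) := by
        gcongr 2 ^ k * ?_
        exact pow_mul_factorial_sub_le_exp_pow_mul_factorial hk.le
    _ = _ := by ring

theorem multinomial_div_multinomial_mul_le {ι : Type*} (n : ℕ) (s : Finset ι) (r : ι → ℕ) :
    (Nat.multinomial s r : ℝ) / Nat.multinomial s (fun i => (n + 1) * r i)
      ≤ (Nat.multinomial s r : ℝ)⁻¹ ^ n := by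
  have hpos : (0 : ℝ) < Nat.multinomial s r := by exact_mod_cast Nat.multinomial_pos _ _
  have hle : (Nat.multinomial s r : ℝ) ^ (n + 1)
      ≤ Nat.multinomial s (fun i => (n + 1) * r i) := by
    exact_mod_cast multinomial_pow_le_multinomial_mul (n + 1) s r
  calc _ ≤ (Nat.multinomial s r : ℝ) / (Nat.multinomial s r : ℝ) ^ (n + 1) := by gcongr
    _ = _ := by rw [pow_succ', div_mul_cancel_left₀ hpos.ne', inv_pow]

theorem sum_pow_le_pow_sum {ι : Type*} (s : Finset ι) {f : ι → ℝ} (hf : ∀ i ∈ s, 0 ≤ f i)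
    {n : ℕ} (hn : n ≠ 0) : ∑ i ∈ s, f i ^ n ≤ (∑ i ∈ s, f i) ^ n := by
  obtain ⟨n, rfl⟩ := Nat.exists_eq_succ_of_ne_zero hn
  rw [pow_succ, Finset.mul_sum]
  refine Finset.sum_le_sum fun i hi => ?_
  rw [pow_succ]
  exact mul_le_mul_of_nonneg_right
    (pow_le_pow_left₀ (hf i hi) (Finset.single_le_sum hf hi) n) (hf i hi)

theorem bcoef_eq_sum_sortedCompositions (m j ℓ : ℕ) :
    bcoef m j ℓ = ∑ r ∈ sortedCompositions j ℓ, (Nat.multinomial Finset.univ r : ℝ)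
      / (Nat.multinomial Finset.univ (fun i => m * r i) : ℝ) := by
  rw [bcoef, ← finsum_mem_coe_finset]
  congr! 4
  ext r
  exact mem_sortedCompositions.symm

/-- for `m ≥ 2`, `ℓ ≥ 3` and `1 ≤ j ≤ ℓ`,
`b_j(ℓ) ≤ (2e/ℓ)^((m−1)(j−1))`. -/
theorem stmt13 (m ℓ : ℕ) (hm : 2 ≤ m) (hl : 3 ≤ ℓ) :
    ∀ j : ℕ, 1 ≤ j → j ≤ ℓ →
      bcoef m j ℓ ≤ (2 * Real.exp 1 / (ℓ : ℝ)) ^ ((m - 1) * (j - 1)) := by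
  intro j hj hjl
  obtain ⟨k, rfl⟩ : ∃ k, j = k + 1 := ⟨j - 1, by omega⟩
  obtain ⟨n, rfl⟩ : ∃ n, m = n + 1 := ⟨m - 1, by omega⟩
  rw [bcoef_eq_sum_sortedCompositions, Nat.add_sub_cancel, Nat.add_sub_cancel, mul_comm n k,
    pow_mul]
  calc _ ≤ ∑ r ∈ sortedCompositions (k + 1) ℓ, (Nat.multinomial Finset.univ r : ℝ)⁻¹ ^ n :=
        Finset.sum_le_sum fun r _ => multinomial_div_multinomial_mul_le n _ r
    _ ≤ (∑ r ∈ sortedCompositions (k + 1) ℓ, (Nat.multinomial Finset.univ r : ℝ)⁻¹) ^ n :=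
        sum_pow_le_pow_sum _ (fun _ _ => by positivity) (by omega)
    _ ≤ _ := by
        gcongr
        exact sum_inv_multinomial_sortedCompositions_le hjl
end

section
/- Let m ≥ 2 and N ≥ 2 be integers. Then the maximum over 1 ≤ j ≤ N−1 of |sin(mjπ/N)| / |sin(jπ/N)| is attained at j = 1; that is, max_{1 ≤ j ≤ N−1} |sin(mjπ/N)| / |sin(jπ/N)| = |sin(mπ/N)| / |sin(π/N)|. -/
/-- On `(0, π / (2m)]` the quotient `sin (m t) / sin t` is nonincreasing in `t`. -/
lemma sin_nat_mul_mul_sin_le (m : ℕ) {x t : ℝ} (hx : 0 ≤ x) (hxt : x ≤ t)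
    (ht : t ≤ Real.pi / 2) (hmt : m * t ≤ Real.pi / 2) :
    Real.sin (m * t) * Real.sin x ≤ Real.sin (m * x) * Real.sin t := by
  have hpi := Real.pi_pos
  induction m with
  | zero => simp
  | succ m ih =>
    push_cast at hmt ⊢
    have hmx0 : 0 ≤ (m : ℝ) * x := by positivity
    have hmxt : (m : ℝ) * x ≤ m * t := by gcongr
    have ih := ih (by linarith)
    have hsx : 0 ≤ Real.sin x := Real.sin_nonneg_of_nonneg_of_le_pi hx (by linarith)
    have hst : 0 ≤ Real.sin t :=
      Real.sin_nonneg_of_nonneg_of_le_pi (by linarith) (by linarith)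
    have hsmx : 0 ≤ Real.sin (m * x) :=
      Real.sin_nonneg_of_nonneg_of_le_pi hmx0 (by linarith)
    have hct : 0 ≤ Real.cos t := Real.cos_nonneg_of_mem_Icc ⟨by linarith, ht⟩
    have hcos : Real.cos t ≤ Real.cos x :=
      Real.cos_le_cos_of_nonneg_of_le_pi hx (by linarith) hxt
    have hcosm : Real.cos (m * t) ≤ Real.cos (m * x) :=
      Real.cos_le_cos_of_nonneg_of_le_pi hmx0 (by linarith) hmxt
    rw [add_mul, add_mul, one_mul, one_mul, Real.sin_add, Real.sin_add]
    have h1 := mul_le_mul_of_nonneg_right ih hct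
    have h2 := mul_le_mul_of_nonneg_left hcos (mul_nonneg hsmx hst)
    have h3 := mul_le_mul_of_nonneg_right hcosm (mul_nonneg hst hsx)
    linarith

lemma abs_sin_nat_mul_mul_sin_le (m : ℕ) {x t : ℝ} (hx : 0 ≤ x) (hxt : x ≤ t)
    (ht : t ≤ Real.pi / 2) (hmx : m * x ≤ Real.pi / 2) :
    |Real.sin (m * t)| * Real.sin x ≤ Real.sin (m * x) * Real.sin t := by
  have hpi := Real.pi_pos
  rcases Nat.eq_zero_or_pos m with rfl | hm
  · simp
  have hm1 : (1 : ℝ) ≤ m := by exact_mod_cast hm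
  have hsx : 0 ≤ Real.sin x := Real.sin_nonneg_of_nonneg_of_le_pi hx (by linarith)
  have hsmx : 0 ≤ Real.sin (m * x) :=
    Real.sin_nonneg_of_nonneg_of_le_pi (by positivity) (by linarith)
  rcases le_total (m * t) (Real.pi / 2) with h | h
  · have hmt0 : 0 ≤ (m : ℝ) * t := mul_nonneg (by linarith) (by linarith)
    rw [abs_of_nonneg (Real.sin_nonneg_of_nonneg_of_le_pi hmt0 (by linarith))]
    exact sin_nat_mul_mul_sin_le m hx hxt ht h
  · have hms : (m : ℝ) * (Real.pi / 2 / m) = Real.pi / 2 := by field_simp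
    have hxs : x ≤ Real.pi / 2 / m := by rw [le_div_iff₀ (by linarith)]; linarith
    have hst : Real.pi / 2 / m ≤ t := by rw [div_le_iff₀ (by linarith)]; linarith
    have key := sin_nat_mul_mul_sin_le m hx hxs (hst.trans ht) hms.le
    rw [hms, Real.sin_pi_div_two] at key
    have hsin : Real.sin (Real.pi / 2 / m) ≤ Real.sin t :=
      Real.sin_le_sin_of_le_of_le_pi_div_two (by linarith) ht hst
    calc |Real.sin (m * t)| * Real.sin x ≤ 1 * Real.sin x := by
          gcongr; exact Real.abs_sin_le_one _
      _ ≤ Real.sin (m * x) * Real.sin (Real.pi / 2 / m) := key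
      _ ≤ Real.sin (m * x) * Real.sin t := by gcongr

lemma abs_sin_add_nat_mul_pi (y : ℝ) (n : ℕ) :
    |Real.sin (y + n * Real.pi)| = |Real.sin y| := by
  rw [Real.sin_add_nat_mul_pi, abs_mul, abs_pow, abs_neg, abs_one, one_pow, one_mul]

/-- Up to sign, every integer is congruent modulo `N` to some `r` with `2r ≤ N`. -/
lemma exists_two_mul_le_abs_sin_eq (m : ℕ) {N : ℕ} (hN : 0 < N) :
    ∃ r : ℕ, 2 * r ≤ N ∧ ∀ j : ℕ,
      |Real.sin (m * (j * (Real.pi / N)))| = |Real.sin (r * (j * (Real.pi / N)))| := by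
  have hN0 : (N : ℝ) ≠ 0 := by positivity
  have hlt := Nat.mod_lt m hN
  have hdiv : ((m % N : ℕ) : ℝ) + N * (m / N : ℕ) = m := by exact_mod_cast Nat.mod_add_div m N
  have hmod (j : ℕ) : |Real.sin (m * (j * (Real.pi / N)))| =
      |Real.sin ((m % N : ℕ) * (j * (Real.pi / N)))| := by
    rw [← abs_sin_add_nat_mul_pi ((m % N : ℕ) * _) (m / N * j), ← hdiv]
    congr 2
    push_cast
    field_simp
  by_cases h : 2 * (m % N) ≤ N
  · exact ⟨m % N, h, hmod⟩
  · refine ⟨N - m % N, by omega, fun j ↦ ?_⟩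
    rw [hmod, ← abs_neg, ← Real.sin_neg, ← abs_sin_add_nat_mul_pi _ j, Nat.cast_sub hlt.le]
    congr 2
    field_simp
    ring

/-- the maximum over `1 ≤ j ≤ N−1` of `|sin(mjπ/N)| / |sin(jπ/N)|` is
attained at `j = 1`. -/
theorem stmt18 (m N : ℕ) (hm : 2 ≤ m) (hN : 2 ≤ N) :
    IsGreatest
      {r : ℝ | ∃ j : ℕ, 1 ≤ j ∧ j ≤ N - 1 ∧
        r = |Real.sin ((m : ℝ) * j * Real.pi / N)| / |Real.sin ((j : ℝ) * Real.pi / N)|}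
      (|Real.sin ((m : ℝ) * Real.pi / N)| / |Real.sin (Real.pi / N)|) := by
  refine ⟨⟨1, le_rfl, by omega, by simp⟩, ?_⟩
  rintro _ ⟨j, hj1, hjN, rfl⟩
  have hpi := Real.pi_pos
  have hNpos : 0 < N := by omega
  have hNR : (0 : ℝ) < N := by exact_mod_cast hNpos
  have sin_pos {k : ℕ} (hk : 1 ≤ k) (hkN : k < N) : 0 < Real.sin (k * (Real.pi / N)) := by
    have hkN : (k : ℝ) < N := by exact_mod_cast hkN
    apply Real.sin_pos_of_pos_of_lt_pi (by positivity)
    rw [← mul_div_assoc, div_lt_iff₀ hNR]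
    nlinarith
  have mul_le {k : ℕ} (hk : 2 * k ≤ N) : k * (Real.pi / N) ≤ Real.pi / 2 := by
    have hk : 2 * (k : ℝ) ≤ N := by exact_mod_cast hk
    rw [← mul_div_assoc, div_le_iff₀ hNR]
    nlinarith
  have hx : 0 < Real.sin (Real.pi / N) := by simpa using sin_pos le_rfl (by omega)
  obtain ⟨p, hp, hmp⟩ := exists_two_mul_le_abs_sin_eq m hNpos
  obtain ⟨i, hi, hji⟩ := exists_two_mul_le_abs_sin_eq j hNpos
  have hj : 0 < Real.sin (j * (Real.pi / N)) := sin_pos hj1 (by omega)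
  have hji1 := hji 1
  have hmp1 := hmp 1
  rw [Nat.cast_one, one_mul] at hji1 hmp1
  have hi1 : 1 ≤ i := by
    rcases Nat.eq_zero_or_pos i with rfl | h
    · simp [hj.ne'] at hji1
    · exact h
  have hmj : |Real.sin (m * (j * (Real.pi / N)))| = |Real.sin (p * (i * (Real.pi / N)))| := by
    rw [hmp, mul_left_comm, hji, mul_left_comm]
  have hsi := sin_pos hi1 (by omega)
  simp only [mul_assoc, mul_div_assoc]
  rw [hmj, hji1, hmp1, abs_of_pos hx, abs_of_pos hsi, div_le_div_iff₀ hsi hx]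
  have hiR : (1 : ℝ) ≤ i := by exact_mod_cast hi1
  refine (abs_sin_nat_mul_mul_sin_le p (by positivity) ?_ (mul_le hi) (mul_le hp)).trans ?_
  · exact le_mul_of_one_le_left (by positivity) hiR
  · gcongr
    exact le_abs_self _
end
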